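/- For every ε > 0 there is a constant K(ε, f, I) such that for every integer J ≥ 2 and every λ ∈ (0,1/8], the sum of |μ(j₁,j₂,p₀,λ)| over all pairs (j₁,j₂) ∈ Θ₂ with |j₁| ≤ J, |j₂| ≤ J and ‖F(x₀)‖ < 2λ is at most K(ε,f,I)(λ^{3/2−ε}J^{3/2} + λ^{1/2}J^{1/2} log J). -/

import Mathlib

open Set Real MeasureTheory
open scoped Classical

/-- Distance from a real number to the nearest integer. -/
noncomputable def nint (y : ℝ) : ℝ := |y - round y|

/-- `h` and `k` are Legendre transforms of each other, `h'` and `k'` being their derivatives, and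
both are strongly convex and smooth with constant `A`. -/
structure LegendrePair (A : ℝ) (h h' k k' : ℝ → ℝ) : Prop where
  lower : ∀ x y, (y - x) ^ 2 / (2 * A) ≤ h y - h x - h' x * (y - x)
  upper : ∀ x y, h y - h x - h' x * (y - x) ≤ A * (y - x) ^ 2 / 2
  lower_dual : ∀ x y, (y - x) ^ 2 / (2 * A) ≤ k y - k x - k' x * (y - x)
  upper_dual : ∀ x y, k y - k x - k' x * (y - x) ≤ A * (y - x) ^ 2 / 2
  left_inv : ∀ x, k' (h' x) = x
  right_inv : ∀ w, h' (k' w) = w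
  legendre : ∀ x, k (h' x) = x * h' x - h x

namespace LegendrePair

variable {A : ℝ} {h h' k k' : ℝ → ℝ}

theorem symm (H : LegendrePair A h h' k k') : LegendrePair A k k' h h' where
  lower := H.lower_dual
  upper := H.upper_dual
  lower_dual := H.lower
  upper_dual := H.upper
  left_inv := H.right_inv
  right_inv := H.left_inv
  legendre w := by
    have := H.legendre (k' w)
    rw [H.right_inv] at this
    linarith

theorem reflect (H : LegendrePair A h h' k k') :
    LegendrePair A (fun x => h (-x)) (fun x => -h' (-x)) (fun x => k (-x))
      (fun x => -k' (-x)) where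
  lower x y := by
    have := H.lower (-x) (-y)
    have e : (-y - -x) ^ 2 = (y - x) ^ 2 := by ring
    rw [e] at this
    linarith
  upper x y := by
    have := H.upper (-x) (-y)
    have e : (-y - -x) ^ 2 = (y - x) ^ 2 := by ring
    rw [e] at this
    linarith
  lower_dual x y := by
    have := H.lower_dual (-x) (-y)
    have e : (-y - -x) ^ 2 = (y - x) ^ 2 := by ring
    rw [e] at this
    linarith
  upper_dual x y := by
    have := H.upper_dual (-x) (-y)
    have e : (-y - -x) ^ 2 = (y - x) ^ 2 := by ring
    rw [e] at this
    linarith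
  left_inv x := by simp [H.left_inv]
  right_inv x := by simp [H.right_inv]
  legendre x := by
    have := H.legendre (-x)
    simp only [neg_neg]
    linarith

theorem mono_deriv (H : LegendrePair A h h' k k') (hA : 1 ≤ A) {x y : ℝ} (hxy : x ≤ y) :
    h' x ≤ h' y := by
  rcases hxy.eq_or_lt with rfl | hlt
  · exact le_rfl
  have h1 := H.lower x y
  have h2 := H.lower y x
  have h3 : 0 ≤ (y - x) ^ 2 / (2 * A) := by positivity
  have h4 : 0 ≤ (x - y) ^ 2 / (2 * A) := by positivity
  by_contra! hc
  nlinarith [mul_pos (sub_pos.2 hlt) (sub_pos.2 hc)]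

theorem deriv_sub_le (H : LegendrePair A h h' k k') {x y : ℝ} (hxy : x ≤ y) :
    h' y - h' x ≤ A * (y - x) := by
  rcases hxy.eq_or_lt with rfl | hlt
  · simp
  have h1 := H.upper x y
  have h2 := H.upper y x
  by_contra! hc
  nlinarith [mul_pos (sub_pos.2 hlt) (sub_pos.2 hc)]

/-- Quadratic growth of `h - w • id` to the right of its minimum. -/
theorem growth_right (H : LegendrePair A h h' k k') (hA : 1 ≤ A) {w x y : ℝ} (hx : k' w ≤ x)
    (hxy : x ≤ y) : (y - x) ^ 2 / (2 * A) ≤ (h y - w * y) - (h x - w * x) := by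
  have h1 := H.lower x y
  have h2 := H.mono_deriv hA hx
  rw [H.right_inv] at h2
  nlinarith [mul_nonneg (sub_nonneg.2 h2) (sub_nonneg.2 hxy)]

/-- The chord-slope inequality for `h - w • id`. -/
theorem slope_le (H : LegendrePair A h h' k k') (hA : 1 ≤ A) (w : ℝ) {x y z : ℝ} (hxy : x ≤ y)
    (hyz : y ≤ z) :
    ((h y - w * y) - (h x - w * x)) * (z - y) ≤ ((h z - w * z) - (h y - w * y)) * (y - x) := by
  have h1 := H.lower y x
  have h2 := H.lower y z
  have h3 : 0 ≤ (x - y) ^ 2 / (2 * A) := by positivity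
  have h4 : 0 ≤ (z - y) ^ 2 / (2 * A) := by positivity
  have h5 : h y - h x ≤ h' y * (y - x) := by linarith
  have h6 : h' y * (z - y) ≤ h z - h y := by linarith
  nlinarith [mul_le_mul_of_nonneg_right h5 (sub_nonneg.2 hyz),
    mul_le_mul_of_nonneg_right h6 (sub_nonneg.2 hxy)]

theorem det_le (H : LegendrePair A h h' k k') (hA : 1 ≤ A) {x y z : ℝ} (hxy : x ≤ y)
    (hyz : y ≤ z) :
    |(y - x) * (h z - h x) - (z - x) * (h y - h x)| ≤ A * (z - x) ^ 3 / 2 := by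
  have a1 := H.lower x y
  have a2 := H.upper x y
  have b1 := H.lower x z
  have b2 := H.upper x z
  have a3 : 0 ≤ (y - x) ^ 2 / (2 * A) := by positivity
  have b3 : 0 ≤ (z - x) ^ 2 / (2 * A) := by positivity
  set u := h y - h x - h' x * (y - x) with hu
  set v := h z - h x - h' x * (z - x) with hv
  have e : (y - x) * (h z - h x) - (z - x) * (h y - h x) = (y - x) * v - (z - x) * u := by
    rw [hu, hv]; ring
  rw [e, abs_le]
  have p : 0 ≤ y - x := by linarith
  have q : 0 ≤ z - x := by linarith
  have r : y - x ≤ z - x := by linarith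
  have hu0 : 0 ≤ u := by linarith
  have hv0 : 0 ≤ v := by linarith
  have s : (y - x) ^ 2 ≤ (z - x) ^ 2 := by gcongr
  have hu1 : u ≤ A * (z - x) ^ 2 / 2 := by nlinarith
  constructor
  · nlinarith [mul_nonneg p hv0, mul_le_mul_of_nonneg_left hu1 q]
  · nlinarith [mul_nonneg q hu0, mul_le_mul_of_nonneg_left b2 q,
      mul_le_mul_of_nonneg_right r hv0]

end LegendrePair

/-- An integer vector with coprime entries, in Bézout form. -/
def IsPrimitive (n : ℤ × ℤ × ℤ) : Prop :=
  ∃ u v w : ℤ, u * n.1 + v * n.2.1 + w * n.2.2 = 1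

theorem exists_primitive_mul (x y z : ℤ) (hx : 0 < x) :
    ∃ (g : ℤ) (n : ℤ × ℤ × ℤ), 0 < g ∧ IsPrimitive n ∧ 0 < n.1 ∧
      x = g * n.1 ∧ y = g * n.2.1 ∧ z = g * n.2.2 := by
  set g : ℤ := (Int.gcd x (Int.gcd y z) : ℤ) with hg
  have hgp : 0 < g := by
    have : 0 < Int.gcd x (Int.gcd y z) := Int.gcd_pos_of_ne_zero_left _ hx.ne'
    rw [hg]; exact_mod_cast this
  obtain ⟨x', hx'⟩ : g ∣ x := Int.gcd_dvd_left ..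
  have hyz : g ∣ (Int.gcd y z : ℤ) := Int.gcd_dvd_right ..
  obtain ⟨y', hy'⟩ : g ∣ y := hyz.trans (Int.gcd_dvd_left ..)
  obtain ⟨z', hz'⟩ : g ∣ z := hyz.trans (Int.gcd_dvd_right ..)
  refine ⟨g, (x', y', z'), hgp, ?_, ?_, hx', hy', hz'⟩
  · have e1 := Int.gcd_eq_gcd_ab x (Int.gcd y z)
    have e2 := Int.gcd_eq_gcd_ab y z
    rw [← hg] at e1
    set s := Int.gcdA x (Int.gcd y z)
    set t := Int.gcdB x (Int.gcd y z)
    refine ⟨s, t * Int.gcdA y z, t * Int.gcdB y z, ?_⟩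
    apply mul_left_cancel₀ hgp.ne'
    rw [e2] at e1
    calc g * (s * x' + t * Int.gcdA y z * y' + t * Int.gcdB y z * z')
        = (g * x') * s + ((g * y') * Int.gcdA y z + (g * z') * Int.gcdB y z) * t := by ring
      _ = g * 1 := by rw [← hx', ← hy', ← hz', mul_one, e1]
  · exact pos_of_mul_pos_right (hx' ▸ hx) hgp.le

theorem IsPrimitive.eq_of_ratio {n m : ℤ × ℤ × ℤ} (hn : IsPrimitive n) (hm : IsPrimitive m)
    (hn0 : 0 < n.1) (hm0 : 0 < m.1) (h1 : m.1 * n.2.1 = n.1 * m.2.1)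
    (h2 : m.1 * n.2.2 = n.1 * m.2.2) : n = m := by
  obtain ⟨u, v, w, e⟩ := hn
  obtain ⟨u', v', w', e'⟩ := hm
  have d1 : n.1 ∣ m.1 := ⟨u * m.1 + v * m.2.1 + w * m.2.2, by
    linear_combination (-m.1) * e + v * h1 + w * h2⟩
  have d2 : m.1 ∣ n.1 := ⟨u' * n.1 + v' * n.2.1 + w' * n.2.2, by
    linear_combination (-n.1) * e' - v' * h1 - w' * h2⟩
  have e1 : n.1 = m.1 := Int.dvd_antisymm hn0.le hm0.le d1 d2
  rw [← e1] at h1 h2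
  exact Prod.ext e1 (Prod.ext (mul_left_cancel₀ hn0.ne' h1) (mul_left_cancel₀ hn0.ne' h2))

/-- The vector `(q, a, b)` lies on the plane with normal `n`. -/
def OnPlane (n : ℤ × ℤ × ℤ) (q a b : ℤ) : Prop := n.1 * b - n.2.1 * a + n.2.2 * q = 0

theorem OnPlane.dvd {n : ℤ × ℤ × ℤ} {q a b q' a' b' : ℤ} (hn : IsPrimitive n)
    (h1 : OnPlane n q a b) (h2 : OnPlane n q' a' b') : n.1 ∣ q * a' - q' * a := by
  obtain ⟨u, v, w, e⟩ := hn
  unfold OnPlane at h1 h2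
  refine ⟨u * (q * a' - q' * a) + v * (q * b' - q' * b) + w * (a * b' - a' * b), ?_⟩
  linear_combination (-(q * a' - q' * a)) * e + (v * q' + w * a') * h1 - (v * q + w * a) * h2

theorem OnPlane.unique {n m : ℤ × ℤ × ℤ} {q a b q' a' b' : ℤ} (hn : IsPrimitive n)
    (hm : IsPrimitive m) (hn0 : 0 < n.1) (hm0 : 0 < m.1)
    (h1 : OnPlane n q a b) (h2 : OnPlane n q' a' b')
    (h3 : OnPlane m q a b) (h4 : OnPlane m q' a' b') (hne : q * a' - q' * a ≠ 0) : n = m := by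
  unfold OnPlane at h1 h2 h3 h4
  refine hn.eq_of_ratio hm hn0 hm0 ?_ ?_
  · apply mul_right_cancel₀ hne
    linear_combination m.1 * (q' * h1 - q * h2) - n.1 * (q' * h3 - q * h4)
  · apply mul_right_cancel₀ hne
    linear_combination m.1 * (a' * h1 - a * h2) - n.1 * (a' * h3 - a * h4)

/-- Two vectors with different ratios `a / q` lie on a common primitive plane, which contains
every third vector whose determinant with them vanishes. -/
theorem exists_plane {q a b q' a' b' : ℤ} (hpos : 0 < q * a' - q' * a) :
    ∃ n : ℤ × ℤ × ℤ, IsPrimitive n ∧ 0 < n.1 ∧ OnPlane n q a b ∧ OnPlane n q' a' b' ∧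
      ∀ q'' a'' b'' : ℤ, (q * a' - q' * a) * b'' - (q * b' - q' * b) * a''
        + (a * b' - a' * b) * q'' = 0 → OnPlane n q'' a'' b'' := by
  obtain ⟨g, n, hg, hn, hn0, e1, e2, e3⟩ :=
    exists_primitive_mul (q * a' - q' * a) (q * b' - q' * b) (a * b' - a' * b) hpos
  have key : ∀ q'' a'' b'' : ℤ, (q * a' - q' * a) * b'' - (q * b' - q' * b) * a''
        + (a * b' - a' * b) * q'' = 0 → OnPlane n q'' a'' b'' := by
    intro q'' a'' b'' h
    rw [e1, e2, e3] at h
    unfold OnPlane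
    apply mul_left_cancel₀ hg.ne'
    linear_combination h
  exact ⟨n, hn, hn0, key _ _ _ (by ring), key _ _ _ (by ring), key⟩

/-- Some integer point `(q, a, b)` with `Q ≤ q < 2Q` and `a / q = y` lies within `δ` of the cone
over the graph of `h`. -/
def IsNear (h : ℝ → ℝ) (Q δ y : ℝ) : Prop :=
  ∃ q a b : ℤ, Q ≤ q ∧ (q : ℝ) < 2 * Q ∧ (a : ℝ) = q * y ∧ |(b : ℝ) - q * h y| ≤ δ

/-- An increasing enumeration of near points in `[x₀, x₀ + 1]` with their integer vectors. -/
structure NearSeq (h : ℝ → ℝ) (Q δ x₀ : ℝ) (r : ℕ) (y : ℕ → ℝ) (q a b : ℕ → ℤ) : Prop where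
  lt : ∀ i j, i < j → j < r → y i < y j
  ge : ∀ i < r, x₀ ≤ y i
  le : ∀ i < r, y i ≤ x₀ + 1
  q_ge : ∀ i < r, Q ≤ q i
  q_lt : ∀ i < r, (q i : ℝ) < 2 * Q
  a_eq : ∀ i < r, (a i : ℝ) = q i * y i
  near : ∀ i < r, |(b i : ℝ) - q i * h (y i)| ≤ δ

/-- The affine form attached to the plane with normal `n`, restricted to the graph of `h`. -/
noncomputable def planeVal (h : ℝ → ℝ) (n : ℤ × ℤ × ℤ) (y : ℝ) : ℝ :=
  n.1 * h y - n.2.1 * y + n.2.2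

section PlaneVal

variable {A : ℝ} {h h' k k' : ℝ → ℝ} {n : ℤ × ℤ × ℤ}

theorem planeVal_growth (H : LegendrePair A h h' k k') (hA : 1 ≤ A) (hn : 0 < n.1) {x y : ℝ}
    (hx : k' (n.2.1 / n.1) ≤ x) (hxy : x ≤ y) :
    n.1 * ((y - x) ^ 2 / (2 * A)) ≤ planeVal h n y - planeVal h n x := by
  have hn' : (0 : ℝ) < n.1 := by exact_mod_cast hn
  have h1 := mul_le_mul_of_nonneg_left (H.growth_right hA hx hxy) hn'.le
  refine h1.trans (le_of_eq ?_)
  unfold planeVal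
  field_simp
  ring

theorem planeVal_mono (H : LegendrePair A h h' k k') (hA : 1 ≤ A) (hn : 0 < n.1) {x y : ℝ}
    (hx : k' (n.2.1 / n.1) ≤ x) (hxy : x ≤ y) : planeVal h n x ≤ planeVal h n y := by
  have h1 := planeVal_growth H hA hn hx hxy
  have hn' : (0 : ℝ) < n.1 := by exact_mod_cast hn
  have h2 : 0 ≤ n.1 * ((y - x) ^ 2 / (2 * A)) := by positivity
  linarith

theorem planeVal_slope (H : LegendrePair A h h' k k') (hA : 1 ≤ A) (hn : 0 < n.1) {x y z : ℝ}
    (hxy : x ≤ y) (hyz : y ≤ z) :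
    (planeVal h n y - planeVal h n x) * (z - y) ≤
      (planeVal h n z - planeVal h n y) * (y - x) := by
  have hn' : (0 : ℝ) < n.1 := by exact_mod_cast hn
  have h1 := mul_le_mul_of_nonneg_left (H.slope_le hA (n.2.1 / n.1) hxy hyz) hn'.le
  have e1 : (planeVal h n y - planeVal h n x) * (z - y) = n.1 * (((h y - n.2.1 / n.1 * y)
      - (h x - n.2.1 / n.1 * x)) * (z - y)) := by
    unfold planeVal
    field_simp
    ring
  have e2 : (planeVal h n z - planeVal h n y) * (y - x) = n.1 * (((h z - n.2.1 / n.1 * z)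
      - (h y - n.2.1 / n.1 * y)) * (y - x)) := by
    unfold planeVal
    field_simp
    ring
  rwa [e1, e2]

theorem planeVal_min (H : LegendrePair A h h' k k') (hn : 0 < n.1) :
    planeVal h n (k' (n.2.1 / n.1)) = n.2.2 - n.1 * k (n.2.1 / n.1) := by
  have hn' : (n.1 : ℝ) ≠ 0 := by exact_mod_cast hn.ne'
  have := H.symm.legendre (n.2.1 / n.1 : ℝ)
  have e := H.legendre (k' (n.2.1 / n.1 : ℝ))
  rw [H.right_inv] at e
  rw [e]
  unfold planeVal
  field_simp
  ring

end PlaneVal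

namespace NearSeq

variable {A : ℝ} {h h' k k' : ℝ → ℝ} {Q δ x₀ : ℝ} {r : ℕ} {y : ℕ → ℝ} {q a b : ℕ → ℤ}

theorem mono (S : NearSeq h Q δ x₀ r y q a b) {i j : ℕ} (hij : i ≤ j) (hj : j < r) :
    y i ≤ y j := by
  rcases hij.eq_or_lt with rfl | hlt
  · exact le_rfl
  · exact (S.lt i j hlt hj).le

theorem sum_gap_le (S : NearSeq h Q δ x₀ r y q a b) {T : Finset ℕ} (hT : T.Nonempty)
    (hr : ∀ i ∈ T, i + 1 < r) :
    ∑ i ∈ T, (y (i + 1) - y i) ≤ y (T.max' hT + 1) - y (T.min' hT) := by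
  have hM := hr _ (T.max'_mem hT)
  have hmM : T.min' hT ≤ T.max' hT + 1 := (T.min'_le _ (T.max'_mem hT)).trans (Nat.le_succ _)
  rw [← Finset.sum_Ico_sub y hmM]
  refine Finset.sum_le_sum_of_subset_of_nonneg ?_ ?_
  · intro i hi
    rw [Finset.mem_Ico]
    exact ⟨T.min'_le _ hi, Nat.lt_succ_of_le (T.le_max' _ hi)⟩
  · intro i hi _
    rw [Finset.mem_Ico] at hi
    have := S.mono (Nat.le_succ i) (by omega)
    simpa using this

theorem sum_gap_le_one (S : NearSeq h Q δ x₀ r y q a b) {T : Finset ℕ}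
    (hr : ∀ i ∈ T, i + 1 < r) : ∑ i ∈ T, (y (i + 1) - y i) ≤ 1 := by
  rcases T.eq_empty_or_nonempty with rfl | hT
  · simp
  · have h1 := S.sum_gap_le hT hr
    have hM := hr _ (T.max'_mem hT)
    have h2 := S.le _ hM
    have h3 := S.ge (T.min' hT) (by have := hr _ (T.min'_mem hT); omega)
    linarith

theorem det_pos (S : NearSeq h Q δ x₀ r y q a b) (hQ : 0 < Q) {i j : ℕ} (hij : i < j)
    (hj : j < r) : 0 < q i * a j - q j * a i ∧
      ((q i * a j - q j * a i : ℤ) : ℝ) ≤ 4 * Q ^ 2 * (y j - y i) := by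
  have h1 := S.lt i j hij hj
  have hi := hij.trans hj
  have e : ((q i * a j - q j * a i : ℤ) : ℝ) = q i * q j * (y j - y i) := by
    push_cast
    rw [S.a_eq i hi, S.a_eq j hj]
    ring
  have pi := S.q_ge i hi
  have pj := S.q_ge j hj
  have pi' := S.q_lt i hi
  have pj' := S.q_lt j hj
  have d : 0 < y j - y i := sub_pos.2 h1
  constructor
  · have hqi : (0 : ℝ) < q i := by linarith
    have hqj : (0 : ℝ) < q j := by linarith
    have : (0 : ℝ) < ((q i * a j - q j * a i : ℤ) : ℝ) := by rw [e]; positivity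
    exact_mod_cast this
  · rw [e]
    apply mul_le_mul_of_nonneg_right _ d.le
    nlinarith

theorem normal_le (S : NearSeq h Q δ x₀ r y q a b) (hQ : 0 < Q) {n : ℤ × ℤ × ℤ}
    (hn : IsPrimitive n) {i j : ℕ} (hij : i < j) (hj : j < r)
    (h1 : OnPlane n (q i) (a i) (b i)) (h2 : OnPlane n (q j) (a j) (b j)) :
    (n.1 : ℝ) ≤ 4 * Q ^ 2 * (y j - y i) := by
  obtain ⟨p, hle⟩ := S.det_pos hQ hij hj
  have := Int.le_of_dvd p (OnPlane.dvd hn h1 h2)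
  have h' : (n.1 : ℝ) ≤ ((q i * a j - q j * a i : ℤ) : ℝ) := by exact_mod_cast this
  linarith

theorem planeVal_le (S : NearSeq h Q δ x₀ r y q a b) {n : ℤ × ℤ × ℤ}
    (hn : 0 < n.1) {i : ℕ} (hi : i < r) (h1 : OnPlane n (q i) (a i) (b i)) :
    Q * |planeVal h n (y i)| ≤ n.1 * δ := by
  have hn' : (0 : ℝ) < n.1 := by exact_mod_cast hn
  have h2 : (n.1 : ℝ) * b i - n.2.1 * a i + n.2.2 * q i = 0 := by exact_mod_cast h1
  have h3 : (q i : ℝ) * planeVal h n (y i) = -(n.1 * (b i - q i * h (y i))) := by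
    unfold planeVal
    rw [S.a_eq i hi] at h2
    linear_combination h2
  have h4 : |(q i : ℝ) * planeVal h n (y i)| ≤ n.1 * δ := by
    rw [h3, abs_neg, abs_mul, abs_of_pos hn']
    exact mul_le_mul_of_nonneg_left (S.near i hi) hn'.le
  rw [abs_mul] at h4
  refine le_trans ?_ h4
  exact mul_le_mul_of_nonneg_right ((S.q_ge i hi).trans (le_abs_self _)) (abs_nonneg _)

theorem onPlane_of_planeVal (S : NearSeq h Q δ x₀ r y q a b) (hQ : 0 < Q) {n : ℤ × ℤ × ℤ}
    (hn : 0 < n.1) {i : ℕ} (hi : i < r)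
    (h1 : 2 * Q * |planeVal h n (y i)| + n.1 * δ < 1) : OnPlane n (q i) (a i) (b i) := by
  have hn' : (0 : ℝ) < n.1 := by exact_mod_cast hn
  have h3 : (n.1 : ℝ) * b i - n.2.1 * a i + n.2.2 * q i =
      q i * planeVal h n (y i) + n.1 * (b i - q i * h (y i)) := by
    unfold planeVal
    rw [S.a_eq i hi]
    ring
  have hq := S.q_ge i hi
  have hq' := S.q_lt i hi
  have h4 : |(n.1 : ℝ) * b i - n.2.1 * a i + n.2.2 * q i| < 1 := by
    rw [h3]
    refine (abs_add_le _ _).trans_lt ?_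
    rw [abs_mul, abs_mul, abs_of_pos hn', abs_of_pos (by linarith : (0 : ℝ) < q i)]
    nlinarith [mul_le_mul_of_nonneg_left (S.near i hi) hn'.le,
      mul_le_mul_of_nonneg_right hq'.le (abs_nonneg (planeVal h n (y i)))]
  unfold OnPlane
  rw [← Int.abs_lt_one_iff]
  exact_mod_cast h4

/-- The consecutive points `i, i + 1` lie on the plane `n`, of size less than `D`, and to the
right of its point of tangency. -/
def RightPlane (_ : NearSeq h Q δ x₀ r y q a b) (k' : ℝ → ℝ) (D : ℝ) (n : ℤ × ℤ × ℤ) (i : ℕ) :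
    Prop :=
  IsPrimitive n ∧ 0 < n.1 ∧ (n.1 : ℝ) < D ∧ i + 1 < r ∧ OnPlane n (q i) (a i) (b i) ∧
    OnPlane n (q (i + 1)) (a (i + 1)) (b (i + 1)) ∧ k' (n.2.1 / n.1) ≤ y i

theorem onPlane_between (S : NearSeq h Q δ x₀ r y q a b) (H : LegendrePair A h h' k k')
    (hA : 1 ≤ A) (hQ : 0 < Q) {n : ℤ × ℤ × ℤ} (hn : 0 < n.1) (hδ : n.1 * δ ≤ 1 / 16)
    {s m i : ℕ} (hs : OnPlane n (q s) (a s) (b s)) (hi : OnPlane n (q i) (a i) (b i))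
    (h0 : k' (n.2.1 / n.1) ≤ y s) (hsm : s ≤ m) (hmi : m ≤ i) (hir : i < r) :
    OnPlane n (q m) (a m) (b m) := by
  have hm := hmi.trans_lt hir
  have m1 := planeVal_mono H hA hn h0 (S.mono hsm hm)
  have m2 := planeVal_mono H hA hn (h0.trans (S.mono hsm hm)) (S.mono hmi hir)
  have p1 := S.planeVal_le hn (hsm.trans_lt hm) hs
  have p2 := S.planeVal_le hn hir hi
  apply S.onPlane_of_planeVal hQ hn hm
  have l1 := neg_abs_le (planeVal h n (y s))
  have l2 := le_abs_self (planeVal h n (y i))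
  have : |planeVal h n (y m)| ≤ max |planeVal h n (y s)| |planeVal h n (y i)| := by
    rw [abs_le]
    constructor
    · have := le_max_left |planeVal h n (y s)| |planeVal h n (y i)|
      linarith
    · have := le_max_right |planeVal h n (y s)| |planeVal h n (y i)|
      linarith
  have : Q * |planeVal h n (y m)| ≤ n.1 * δ := by
    refine (mul_le_mul_of_nonneg_left this hQ.le).trans ?_
    rcases max_choice |planeVal h n (y s)| |planeVal h n (y i)| with e | e <;> rw [e] <;>
      assumption
  linarith

theorem fiber_card_le (S : NearSeq h Q δ x₀ r y q a b) (hQ : 0 < Q) {n : ℤ × ℤ × ℤ} {D : ℝ}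
    {T : Finset ℕ} (hT : T.Nonempty) (hR : ∀ i ∈ T, S.RightPlane k' D n i) :
    (n.1 : ℝ) * T.card ≤ 4 * Q ^ 2 * (y (T.max' hT + 1) - y (T.min' hT)) := by
  have h1 := S.sum_gap_le hT (fun i hi => (hR i hi).2.2.2.1)
  have h2 : ∑ i ∈ T, (n.1 : ℝ) ≤ ∑ i ∈ T, 4 * Q ^ 2 * (y (i + 1) - y i) := by
    apply Finset.sum_le_sum
    intro i hi
    obtain ⟨hp, -, -, hr, o1, o2, -⟩ := hR i hi
    exact S.normal_le hQ hp (Nat.lt_succ_self i) hr o1 o2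
  rw [Finset.sum_const, nsmul_eq_mul, ← Finset.mul_sum] at h2
  have := mul_le_mul_of_nonneg_left h1 (by positivity : 0 ≤ 4 * Q ^ 2)
  linarith

theorem fiber_card_le_sqrt (S : NearSeq h Q δ x₀ r y q a b) (H : LegendrePair A h h' k k')
    (hA : 1 ≤ A) (hQ : 0 < Q) {n : ℤ × ℤ × ℤ} {D : ℝ}
    {T : Finset ℕ} (hR : ∀ i ∈ T, S.RightPlane k' D n i) :
    (n.1 : ℝ) * T.card ≤ 8 * √A * √(δ * Q ^ 3) := by
  rcases T.eq_empty_or_nonempty with rfl | hT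
  · simp; positivity
  refine (S.fiber_card_le hQ hT hR).trans ?_
  obtain ⟨-, hn, -, hr1, o1, -, h0⟩ := hR _ (T.min'_mem hT)
  obtain ⟨-, -, -, hr2, -, o2, -⟩ := hR _ (T.max'_mem hT)
  have hmM : T.min' hT ≤ T.max' hT + 1 := (T.min'_le _ (T.max'_mem hT)).trans (Nat.le_succ _)
  set s := T.min' hT
  set M := T.max' hT + 1
  have g := planeVal_growth H hA hn h0 (S.mono hmM hr2)
  have p1 := S.planeVal_le hn (hmM.trans_lt hr2) o1
  have p2 := S.planeVal_le hn hr2 o2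
  have l1 := neg_abs_le (planeVal h n (y s))
  have l2 := le_abs_self (planeVal h n (y M))
  have hn' : (0 : ℝ) < n.1 := by exact_mod_cast hn
  have e : Q * (n.1 * ((y M - y s) ^ 2 / (2 * A))) ≤ 2 * (n.1 * δ) := by
    have := mul_le_mul_of_nonneg_left g hQ.le
    nlinarith
  have e2 : Q * (y M - y s) ^ 2 ≤ 4 * A * δ := by
    have hA0 : 0 < 2 * A := by linarith
    have : n.1 * (Q * (y M - y s) ^ 2) ≤ n.1 * (4 * A * δ) := by
      have := mul_le_mul_of_nonneg_right e hA0.le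
      have e3 : Q * (n.1 * ((y M - y s) ^ 2 / (2 * A))) * (2 * A) =
        n.1 * (Q * (y M - y s) ^ 2) := by field_simp
      rw [e3] at this
      linarith
    exact le_of_mul_le_mul_left this hn'
  rw [mul_assoc 8, ← Real.sqrt_mul (by linarith)]
  have : 4 * Q ^ 2 * (y M - y s) / 8 ≤ √(A * (δ * Q ^ 3)) := by
    apply Real.le_sqrt_of_sq_le
    have hQ3 : 0 ≤ Q ^ 3 := by positivity
    nlinarith [mul_le_mul_of_nonneg_left e2 hQ3]
  linarith

end NearSeq

/-- Uniform bound for the number of near points in an interval of length one. -/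
def CountBound (A Q δ B : ℝ) : Prop :=
  ∀ h h' k k' : ℝ → ℝ, LegendrePair A h h' k k' → ∀ (x₀ : ℝ) (Y : Finset ℝ),
    (∀ y ∈ Y, x₀ ≤ y ∧ y ≤ x₀ + 1 ∧ IsNear h Q δ y) → (Y.card : ℝ) ≤ B

theorem CountBound.mono {A Q δ B B' : ℝ} (hB : CountBound A Q δ B) (h : B ≤ B') :
    CountBound A Q δ B' :=
  fun _ _ _ _ H x₀ Y hY => (hB _ _ _ _ H x₀ Y hY).trans h

theorem CountBound.card_le_mul {A Q δ B : ℝ} (hB : CountBound A Q δ B) {h h' k k' : ℝ → ℝ}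
    (H : LegendrePair A h h' k k') (N : ℕ) (x₀ : ℝ) (Y : Finset ℝ)
    (hY : ∀ y ∈ Y, x₀ ≤ y ∧ y < x₀ + N ∧ IsNear h Q δ y) : (Y.card : ℝ) ≤ N * B := by
  induction N generalizing Y with
  | zero =>
    have : Y = ∅ := Finset.eq_empty_of_forall_notMem fun y hy => by
      have := hY y hy
      simp only [Nat.cast_zero, add_zero] at this
      linarith [this.1, this.2.1]
    simp [this]
  | succ N ih =>
    have h1 := ih (Y.filter (fun y => y < x₀ + N)) (fun y hy => by
      rw [Finset.mem_filter] at hy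
      exact ⟨(hY y hy.1).1, hy.2, (hY y hy.1).2.2⟩)
    have h2 := hB _ _ _ _ H (x₀ + N) (Y.filter (fun y => ¬ y < x₀ + N)) (fun y hy => by
      rw [Finset.mem_filter, not_lt] at hy
      obtain ⟨-, b, c⟩ := hY y hy.1
      push_cast at b
      exact ⟨hy.2, by linarith, c⟩)
    have h3 := Finset.card_filter_add_card_filter_not (s := Y) (fun y => y < x₀ + N)
    have h4 : (Y.card : ℝ) = (Y.filter (fun y => y < x₀ + N)).card
        + (Y.filter (fun y => ¬ y < x₀ + N)).card := by exact_mod_cast h3.symm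
    rw [h4]
    push_cast
    linarith

namespace NearSeq

variable {A : ℝ} {h h' k k' : ℝ → ℝ} {Q δ x₀ : ℝ} {r : ℕ} {y : ℕ → ℝ} {q a b : ℕ → ℤ}

/-- A plane far from tangency carries points only after a gap of proportional length. -/
theorem gap_before_transversal (S : NearSeq h Q δ x₀ r y q a b) (H : LegendrePair A h h' k k')
    (hA : 1 ≤ A) (hQ : 0 < Q) {c : ℝ} (hc : 0 < c) (hc4 : c ≤ 1 / 4)
    {n : ℤ × ℤ × ℤ} (hn : 0 < n.1) (hnδ : n.1 * δ ≤ c ^ 2)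
    (htr : planeVal h n (k' (n.2.1 / n.1)) < -(c / Q)) {s M : ℕ} (hsM : s + 1 ≤ M) (hM : M < r)
    (h0 : k' (n.2.1 / n.1) ≤ y (s + 1)) (os : OnPlane n (q (s + 1)) (a (s + 1)) (b (s + 1)))
    (oM : OnPlane n (q M) (a M) (b M))
    (hmin : ¬ (OnPlane n (q s) (a s) (b s) ∧ k' (n.2.1 / n.1) ≤ y s)) :
    y M - y (s + 1) ≤ 4 * n.1 * δ / c * (y (s + 1) - y s) := by
  have hn' : (0 : ℝ) < n.1 := by exact_mod_cast hn
  have hs1 : s + 1 < r := hsM.trans_lt hM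
  have p1 := S.planeVal_le hn hs1 os
  have p2 := S.planeVal_le hn hM oM
  have l1 := abs_le.1 (le_refl |planeVal h n (y (s + 1))|)
  have l2 := abs_le.1 (le_refl |planeVal h n (y M)|)
  have hlt := S.lt s (s + 1) (Nat.lt_succ_self s) hs1
  have hδ0 : 0 ≤ n.1 * δ := le_trans (by positivity) p1
  obtain ⟨x, hxs, hxl, hxv⟩ : ∃ x, x ≤ y (s + 1) ∧ y s ≤ x ∧ Q * planeVal h n x ≤ -c := by
    by_cases hy : k' (n.2.1 / n.1) ≤ y s
    · refine ⟨y s, hlt.le, le_rfl, ?_⟩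
      have hno : ¬ OnPlane n (q s) (a s) (b s) := fun o => hmin ⟨o, hy⟩
      have h1 : 1 ≤ 2 * Q * |planeVal h n (y s)| + n.1 * δ := by
        by_contra! hcon
        exact hno (S.onPlane_of_planeVal hQ hn ((Nat.lt_succ_self s).trans hs1) hcon)
      have h2 := planeVal_mono H hA hn hy hlt.le
      have h3 : Q * planeVal h n (y s) ≤ n.1 * δ := by
        have := mul_le_mul_of_nonneg_left (h2.trans l1.2) hQ.le
        linarith
      rcases abs_cases (planeVal h n (y s)) with ⟨e, _⟩ | ⟨e, _⟩
      · rw [e] at h1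
        nlinarith
      · rw [e] at h1
        nlinarith
    · refine ⟨_, h0, (not_le.1 hy).le, ?_⟩
      have := mul_le_mul_of_nonneg_left htr.le hQ.le
      rwa [mul_neg, mul_div_cancel₀ _ hQ.ne'] at this
  have hyM := S.mono hsM hM
  have sl := planeVal_slope H hA hn hxs hyM
  have sl' := mul_le_mul_of_nonneg_left sl hQ.le
  set L := y M - y (s + 1)
  set U := y (s + 1) - x with hU
  have hL : 0 ≤ L := sub_nonneg.2 hyM
  have hU0 : 0 ≤ U := sub_nonneg.2 hxs
  have v1 : -(n.1 * δ) ≤ Q * planeVal h n (y (s + 1)) := by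
    nlinarith [mul_le_mul_of_nonneg_left l1.1 hQ.le]
  have v2 : Q * planeVal h n (y M) ≤ n.1 * δ := by
    nlinarith [mul_le_mul_of_nonneg_left l2.2 hQ.le]
  have t1 : c / 2 * L ≤ Q * ((planeVal h n (y (s + 1)) - planeVal h n x) * L) := by
    rw [← mul_assoc]
    apply mul_le_mul_of_nonneg_right _ hL
    nlinarith
  have t2 : Q * ((planeVal h n (y M) - planeVal h n (y (s + 1))) * U) ≤ 2 * (n.1 * δ) * U := by
    rw [← mul_assoc]
    apply mul_le_mul_of_nonneg_right _ hU0
    linarith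
  have t3 : 2 * (n.1 * δ) * U ≤ 2 * (n.1 * δ) * (y (s + 1) - y s) := by
    apply mul_le_mul_of_nonneg_left _ (by positivity)
    rw [hU]; linarith
  rw [div_mul_eq_mul_div, le_div_iff₀ hc]
  linarith

theorem card_transversal_le (S : NearSeq h Q δ x₀ r y q a b) (H : LegendrePair A h h' k k')
    (hA : 1 ≤ A) (hQ : 0 < Q) (hδ : 0 ≤ δ) {c D : ℝ} (hc : 0 < c) (hc4 : c ≤ 1 / 4)
    (hDδ : D * δ ≤ c ^ 2) {T : Finset ℕ} {n : ℕ → ℤ × ℤ × ℤ}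
    (hR : ∀ i ∈ T, S.RightPlane k' D (n i) i)
    (htr : ∀ i ∈ T, planeVal h (n i) (k' ((n i).2.1 / (n i).1)) < -(c / Q)) :
    (T.card : ℝ) ≤ 16 / c * (δ * Q ^ 2) + 8 * √A * √(δ * Q ^ 3) := by
  have hc16 : c ^ 2 ≤ 1 / 16 := by nlinarith
  have hnδ : ∀ i ∈ T, (n i).1 * δ ≤ c ^ 2 := fun i hi =>
    (mul_le_mul_of_nonneg_right (hR i hi).2.2.1.le hδ).trans hDδ
  set P : ℕ → ℕ → Prop := fun i m => OnPlane (n i) (q m) (a m) (b m) ∧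
    k' ((n i).2.1 / (n i).1) ≤ y m with hP
  have hex : ∀ i ∈ T, P i i := fun i hi => ⟨(hR i hi).2.2.2.2.1, (hR i hi).2.2.2.2.2.2⟩
  set s : ℕ → ℕ := fun i => sInf {m | P i m} with hs
  have hsle : ∀ i ∈ T, s i ≤ i := fun i hi => Nat.sInf_le (hex i hi)
  have hsP : ∀ i ∈ T, P i (s i) := fun i hi =>
    Nat.sInf_mem (s := {m | P i m}) ⟨i, hex i hi⟩
  have hsmin : ∀ i m, m < s i → ¬ P i m := fun i m hm hPm => Nat.notMem_of_lt_sInf hm hPm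
  set C := 16 / c * (δ * Q ^ 2) with hC
  set W := 8 * √A * √(δ * Q ^ 3) with hW
  have hC0 : 0 ≤ C := by positivity
  have hW0 : 0 ≤ W := by positivity
  have hsame : ∀ i ∈ T, ∀ i' ∈ T, s i = s i' → n i = n i' := by
    have hnext : ∀ i ∈ T, OnPlane (n i) (q (s i + 1)) (a (s i + 1)) (b (s i + 1)) := by
      intro i hi
      obtain ⟨-, hn, -, hr, -, o2, -⟩ := hR i hi
      exact S.onPlane_between H hA hQ hn ((hnδ i hi).trans hc16) (hsP i hi).1 o2 (hsP i hi).2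
        (Nat.le_succ _) (Nat.succ_le_succ (hsle i hi)) hr
    intro i hi i' hi' e
    have hlt : s i + 1 < r := (Nat.succ_le_succ (hsle i hi)).trans_lt (hR i hi).2.2.2.1
    refine OnPlane.unique (hR i hi).1 (hR i' hi').1 (hR i hi).2.1 (hR i' hi').2.1
      (hsP i hi).1 (hnext i hi) ?_ ?_ (S.det_pos hQ (Nat.lt_succ_self (s i)) hlt).1.ne'
    · rw [e]; exact (hsP i' hi').1
    · rw [e]; exact hnext i' hi'
  set g : ℕ → ℝ := fun t => match t with
    | 0 => W
    | t + 1 => C * (y (t + 1) - y t) with hg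
  have hfib : ∀ t ∈ T.image s, ((T.filter (fun i => s i = t)).card : ℝ) ≤ g t := by
    intro t ht
    obtain ⟨i₀, hi₀, rfl⟩ := Finset.mem_image.1 ht
    set F := T.filter (fun i => s i = s i₀) with hF
    have hFne : F.Nonempty := ⟨i₀, Finset.mem_filter.2 ⟨hi₀, rfl⟩⟩
    have hFR : ∀ i ∈ F, S.RightPlane k' D (n i₀) i := by
      intro i hi
      rw [Finset.mem_filter] at hi
      rw [← hsame i hi.1 i₀ hi₀ hi.2]
      exact hR i hi.1
    have hn := (hR i₀ hi₀).2.1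
    have hn' : (1 : ℝ) ≤ (n i₀).1 := by exact_mod_cast hn
    rcases h : s i₀ with _ | t
    · have := S.fiber_card_le_sqrt H hA hQ hFR
      have h2 : (F.card : ℝ) ≤ (n i₀).1 * F.card :=
        le_mul_of_one_le_left (by positivity) hn'
      exact h2.trans this
    · have h1 := S.fiber_card_le hQ hFne hFR
      have hmaxR := hFR _ (F.max'_mem hFne)
      have hminT := Finset.mem_filter.1 (F.min'_mem hFne)
      have hmaxT := Finset.mem_filter.1 (F.max'_mem hFne)
      have htmin : t + 1 ≤ F.min' hFne := by
        rw [← h, ← hminT.2]; exact hsle _ hminT.1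
      have htmax : t + 1 ≤ F.max' hFne + 1 := by
        rw [← h, ← hmaxT.2]; exact (hsle _ hmaxT.1).trans (Nat.le_succ _)
      have hP₀ := hsP i₀ hi₀
      rw [h] at hP₀
      have h2 := S.gap_before_transversal H hA hQ hc hc4 hn (hnδ i₀ hi₀) (htr i₀ hi₀) htmax
        hmaxR.2.2.2.1 hP₀.2 hP₀.1 hmaxR.2.2.2.2.2.1 (hsmin i₀ t (by omega))
      have h3 : y (t + 1) ≤ y (F.min' hFne) :=
        S.mono htmin (by have := (hFR _ (F.min'_mem hFne)).2.2.2.1; omega)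
      have h4 : ((n i₀).1 : ℝ) * F.card ≤ (n i₀).1 * (C * (y (t + 1) - y t)) := by
        calc ((n i₀).1 : ℝ) * F.card
            ≤ 4 * Q ^ 2 * (y (F.max' hFne + 1) - y (t + 1)) := by
              refine h1.trans ?_
              gcongr
          _ ≤ 4 * Q ^ 2 * (4 * (n i₀).1 * δ / c * (y (t + 1) - y t)) := by gcongr
          _ = (n i₀).1 * (C * (y (t + 1) - y t)) := by rw [hC]; ring
      exact le_of_mul_le_mul_left h4 (by linarith)
  rcases Nat.eq_zero_or_pos r with hr0 | hr0
  · have : T = ∅ := Finset.eq_empty_of_forall_notMem fun i hi => by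
      have := (hR i hi).2.2.2.1
      omega
    rw [this]
    simpa using add_nonneg hC0 hW0
  obtain ⟨r', rfl⟩ := Nat.exists_eq_succ_of_ne_zero hr0.ne'
  calc (T.card : ℝ) = ∑ t ∈ T.image s, ((T.filter (fun i => s i = t)).card : ℝ) := by
        exact_mod_cast Finset.card_eq_sum_card_image s T
    _ ≤ ∑ t ∈ T.image s, g t := Finset.sum_le_sum hfib
    _ ≤ ∑ t ∈ Finset.range (r' + 1), g t := by
        apply Finset.sum_le_sum_of_subset_of_nonneg
        · intro t ht
          obtain ⟨i, hi, rfl⟩ := Finset.mem_image.1 ht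
          rw [Finset.mem_range]
          have := hsle i hi
          have := (hR i hi).2.2.2.1
          omega
        · intro t ht _
          rw [Finset.mem_range] at ht
          rcases t with _ | t
          · exact hW0
          · exact mul_nonneg hC0 (sub_nonneg.2 (S.mono (Nat.le_succ t) ht))
    _ = C * ∑ t ∈ Finset.range r', (y (t + 1) - y t) + W := by
        rw [Finset.sum_range_succ', Finset.mul_sum]
    _ ≤ C + W := by
        have := S.sum_gap_le_one (T := Finset.range r') (fun i hi => by
          rw [Finset.mem_range] at hi; omega)
        nlinarith

end NearSeq

namespace NearSeq

variable {A : ℝ} {h h' k k' : ℝ → ℝ} {Q δ x₀ : ℝ} {r : ℕ} {y : ℕ → ℝ} {q a b : ℕ → ℤ}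

/-- A nearly tangent plane gives a near point of the dual function. -/
theorem tangent_plane (S : NearSeq h Q δ x₀ r y q a b) (H : LegendrePair A h h' k k')
    (hA : 1 ≤ A) (hQ : 1 ≤ Q) (hδ : 0 ≤ δ) {c D : ℝ} (hc : 0 < c) (hc4 : c ≤ 1 / 4)
    (hDδ : D * δ ≤ c ^ 2) {n : ℤ × ℤ × ℤ} {i : ℕ} (hR : S.RightPlane k' D n i)
    (htan : -(c / Q) ≤ planeVal h n (k' (n.2.1 / n.1))) :
    |(n.2.2 : ℝ) - n.1 * k (n.2.1 / n.1)| ≤ c / Q ∧ h' (x₀ - A) ≤ n.2.1 / n.1 ∧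
      (n.2.1 / n.1 : ℝ) ≤ h' (x₀ - A) + A * (1 + A) := by
  obtain ⟨-, hn, hnD, hr, o1, -, h0⟩ := hR
  have hn' : (1 : ℝ) ≤ n.1 := by exact_mod_cast hn
  have hQ0 : 0 < Q := by linarith
  have hir : i < r := (Nat.lt_succ_self i).trans hr
  have p1 := S.planeVal_le hn hir o1
  have g := planeVal_growth H hA hn le_rfl h0
  have hg0 : 0 ≤ n.1 * ((y i - k' (n.2.1 / n.1)) ^ 2 / (2 * A)) := by positivity
  have hnδ : n.1 * δ ≤ c ^ 2 := (mul_le_mul_of_nonneg_right hnD.le hδ).trans hDδ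
  have hup : planeVal h n (y i) ≤ c / Q := by
    rw [le_div_iff₀ hQ0]
    have := mul_le_mul_of_nonneg_left (le_abs_self (planeVal h n (y i))) hQ0.le
    nlinarith
  have hcQ : c / Q ≤ 1 / 4 := (div_le_self hc.le hQ).trans hc4
  rw [planeVal_min H hn] at htan g
  have hlow : y i - k' (n.2.1 / n.1) ≤ A := by
    have h1 : (y i - k' (n.2.1 / n.1)) ^ 2 / (2 * A) ≤ 1 / 2 := by
      have : (y i - k' (n.2.1 / n.1)) ^ 2 / (2 * A) ≤
          n.1 * ((y i - k' (n.2.1 / n.1)) ^ 2 / (2 * A)) :=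
        le_mul_of_one_le_left (by positivity) hn'
      linarith
    rw [div_le_iff₀ (by linarith)] at h1
    by_contra! hcon
    nlinarith
  have hx1 : x₀ - A ≤ k' (n.2.1 / n.1) := by linarith [S.ge i hir]
  have hx2 : k' (n.2.1 / n.1) ≤ x₀ + 1 := h0.trans (S.le i hir)
  have d1 := H.mono_deriv hA hx1
  have d2 := H.deriv_sub_le hx1
  rw [H.right_inv] at d1 d2
  refine ⟨abs_le.2 ⟨htan, by linarith⟩, d1, ?_⟩
  nlinarith

theorem card_tangential_le (S : NearSeq h Q δ x₀ r y q a b) (H : LegendrePair A h h' k k')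
    (hA : 1 ≤ A) (hQ : 1 ≤ Q) (hδ : 0 ≤ δ) {c D : ℝ} (hc : 0 < c) (hc4 : c ≤ 1 / 4)
    (hDδ : D * δ ≤ c ^ 2) (hDQ : D ≤ c ^ 2 * Q) {K : ℕ} (hDK : D ≤ 2 ^ K) {B : ℕ → ℝ}
    (hB : ∀ m < K, CountBound A (2 ^ m) (c ^ 2 / 2 ^ m) (B m)) {T : Finset ℕ}
    {n : ℕ → ℤ × ℤ × ℤ} (hR : ∀ i ∈ T, S.RightPlane k' D (n i) i)
    (htan : ∀ i ∈ T, -(c / Q) ≤ planeVal h (n i) (k' ((n i).2.1 / (n i).1))) :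
    (T.card : ℝ) ≤ 8 * √A * √(δ * Q ^ 3) * ((⌈A * (1 + A)⌉₊ + 1 : ℕ) : ℝ) *
      ∑ m ∈ Finset.range K, B m / 2 ^ m := by
  have hQ0 : 0 < Q := by linarith
  set W := 8 * √A * √(δ * Q ^ 3) with hW
  set N := ⌈A * (1 + A)⌉₊ + 1 with hN
  have hW0 : 0 ≤ W := by positivity
  set P := T.image n with hP
  have hfib : ∀ p ∈ P, ((T.filter (fun i => n i = p)).card : ℝ) ≤ W / p.1 := by
    intro p hp
    obtain ⟨i₀, hi₀, rfl⟩ := Finset.mem_image.1 hp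
    have hn : (0 : ℝ) < (n i₀).1 := by exact_mod_cast (hR i₀ hi₀).2.1
    rw [le_div_iff₀ hn, mul_comm]
    refine S.fiber_card_le_sqrt H hA hQ0 (D := D) fun i hi => ?_
    rw [Finset.mem_filter] at hi
    rw [← hi.2]
    exact hR i hi.1
  set e : ℤ × ℤ × ℤ → ℕ := fun p => Nat.log 2 p.1.toNat with he
  have hpow : ∀ p ∈ P, (2 : ℝ) ^ e p ≤ p.1 ∧ (p.1 : ℝ) < 2 * 2 ^ e p := by
    intro p hp
    obtain ⟨i₀, hi₀, rfl⟩ := Finset.mem_image.1 hp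
    have hn := (hR i₀ hi₀).2.1
    have h1 := Nat.pow_log_le_self 2 (x := (n i₀).1.toNat) (by omega)
    have h2 := Nat.lt_pow_succ_log_self (b := 2) (by norm_num) (n i₀).1.toNat
    have hz : (((n i₀).1.toNat : ℕ) : ℝ) = (n i₀).1 := by
      exact_mod_cast Int.toNat_of_nonneg hn.le
    rw [pow_succ, mul_comm] at h2
    constructor
    · rw [← hz]; exact_mod_cast h1
    · rw [← hz]; exact_mod_cast h2
  have heK : ∀ p ∈ P, e p ∈ Finset.range K := by
    intro p hp
    have h1 := (hpow p hp).1
    obtain ⟨i₀, hi₀, rfl⟩ := Finset.mem_image.1 hp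
    have h2 := (hR i₀ hi₀).2.2.1
    rw [Finset.mem_range]
    by_contra! hcon
    have : (2 : ℝ) ^ K ≤ 2 ^ e (n i₀) := pow_le_pow_right₀ (by norm_num) hcon
    linarith
  have hblock : ∀ m ∈ Finset.range K, ((P.filter (fun p => e p = m)).card : ℝ) ≤ N * B m := by
    intro m hm
    rw [Finset.mem_range] at hm
    set ratio : ℤ × ℤ × ℤ → ℝ := fun p => (p.2.1 / p.1 : ℝ) with hratio
    have hinj : Set.InjOn ratio (P.filter (fun p => e p = m) : Finset _) := by
      intro p hp p' hp' hpp
      rw [Finset.mem_coe, Finset.mem_filter] at hp hp'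
      obtain ⟨i, hi, rfl⟩ := Finset.mem_image.1 hp.1
      obtain ⟨i', hi', rfl⟩ := Finset.mem_image.1 hp'.1
      have t1 := (S.tangent_plane H hA hQ hδ hc hc4 hDδ (hR i hi) (htan i hi)).1
      have t2 := (S.tangent_plane H hA hQ hδ hc hc4 hDδ (hR i' hi') (htan i' hi')).1
      obtain ⟨g1, g2, g3, -⟩ := hR i hi
      obtain ⟨g1', g2', g3', -⟩ := hR i' hi'
      have f2 : (0 : ℝ) < (n i).1 := by exact_mod_cast g2
      have f2' : (0 : ℝ) < (n i').1 := by exact_mod_cast g2'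
      simp only [hratio] at hpp
      rw [← hpp] at t2
      set κ := k ((n i).2.1 / (n i).1)
      rw [div_eq_div_iff f2.ne' f2'.ne'] at hpp
      refine g1.eq_of_ratio g1' g2 g2' ?_ ?_
      · have : ((n i').1 : ℝ) * (n i).2.1 = (n i).1 * (n i').2.1 := by linarith
        exact_mod_cast this
      · have e1 : ((n i').1 : ℝ) * (n i).2.2 - (n i).1 * (n i').2.2 =
            (n i').1 * ((n i).2.2 - (n i).1 * κ) - (n i).1 * ((n i').2.2 - (n i').1 * κ) := by
          ring
        have e2 : |((n i').1 : ℝ) * (n i).2.2 - (n i).1 * (n i').2.2| < 1 := by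
          rw [e1]
          refine (abs_sub _ _).trans_lt ?_
          rw [abs_mul, abs_mul, abs_of_pos f2, abs_of_pos f2']
          have u1 : ((n i').1 : ℝ) * |(n i).2.2 - (n i).1 * κ| ≤ c ^ 2 * Q * (c / Q) := by
            apply mul_le_mul (by linarith) t1 (abs_nonneg _) (by positivity)
          have u2 : ((n i).1 : ℝ) * |(n i').2.2 - (n i').1 * κ| ≤ c ^ 2 * Q * (c / Q) := by
            apply mul_le_mul (by linarith) t2 (abs_nonneg _) (by positivity)
          have u3 : c ^ 2 * Q * (c / Q) = c ^ 3 := by field_simp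
          have u4 : c ^ 3 ≤ (1 / 4) ^ 3 := by gcongr
          rw [u3] at u1 u2
          linarith
        have e3 : |(n i').1 * (n i).2.2 - (n i).1 * (n i').2.2| < 1 := by exact_mod_cast e2
        have := Int.abs_lt_one_iff.1 e3
        linarith
    rw [← Finset.card_image_of_injOn hinj]
    refine (hB m hm).card_le_mul H.symm N (h' (x₀ - A)) _ fun w hw => ?_
    obtain ⟨p, hp, rfl⟩ := Finset.mem_image.1 hw
    rw [Finset.mem_filter] at hp
    obtain ⟨l1, l2⟩ := hpow p hp.1
    rw [hp.2] at l1 l2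
    obtain ⟨i, hi, rfl⟩ := Finset.mem_image.1 hp.1
    obtain ⟨t1, t2, t3⟩ := S.tangent_plane H hA hQ hδ hc hc4 hDδ (hR i hi) (htan i hi)
    have f2 : (0 : ℝ) < (n i).1 := by exact_mod_cast (hR i hi).2.1
    have f3 := (hR i hi).2.2.1
    refine ⟨t2, ?_, (n i).1, (n i).2.1, (n i).2.2, l1, l2, ?_, t1.trans ?_⟩
    · have := Nat.le_ceil (A * (1 + A))
      rw [hN]
      push_cast
      simp only [hratio]
      linarith
    · simp only [hratio]
      field_simp
    · rw [div_le_div_iff₀ hQ0 (by positivity)]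
      have : c * 2 ^ m ≤ c * (c * Q) := by
        gcongr
        nlinarith
      linarith
  calc (T.card : ℝ) = ∑ p ∈ P, ((T.filter (fun i => n i = p)).card : ℝ) := by
        exact_mod_cast Finset.card_eq_sum_card_image n T
    _ ≤ ∑ p ∈ P, W / p.1 := Finset.sum_le_sum hfib
    _ ≤ ∑ p ∈ P, W / 2 ^ e p := by
        apply Finset.sum_le_sum
        intro p hp
        have := (hpow p hp).1
        gcongr
    _ = ∑ m ∈ Finset.range K, ∑ p ∈ P.filter (fun p => e p = m), W / 2 ^ e p :=
        (Finset.sum_fiberwise_of_maps_to heK _).symm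
    _ ≤ ∑ m ∈ Finset.range K, W * N * (B m / 2 ^ m) := by
        apply Finset.sum_le_sum
        intro m hm
        have : ∑ p ∈ P.filter (fun p => e p = m), W / 2 ^ e p =
            (P.filter (fun p => e p = m)).card * (W / 2 ^ m) := by
          rw [← nsmul_eq_mul, ← Finset.sum_const]
          apply Finset.sum_congr rfl
          intro p hp
          rw [(Finset.mem_filter.1 hp).2]
        rw [this]
        calc ((P.filter (fun p => e p = m)).card : ℝ) * (W / 2 ^ m)
            ≤ (N * B m) * (W / 2 ^ m) := by
              apply mul_le_mul_of_nonneg_right (hblock m hm); positivity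
          _ = W * N * (B m / 2 ^ m) := by ring
    _ = W * N * ∑ m ∈ Finset.range K, B m / 2 ^ m := by rw [Finset.mul_sum]

end NearSeq

theorem exists_nearSeq {h : ℝ → ℝ} {Q δ x₀ : ℝ} {Y : Finset ℝ}
    (hY : ∀ y ∈ Y, x₀ ≤ y ∧ y ≤ x₀ + 1 ∧ IsNear h Q δ y) :
    ∃ (y : ℕ → ℝ) (q a b : ℕ → ℤ), NearSeq h Q δ x₀ Y.card y q a b := by
  set y : ℕ → ℝ := fun i => if hi : i < Y.card then Y.orderEmbOfFin rfl ⟨i, hi⟩ else 0 with hy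
  have hmem : ∀ i < Y.card, y i ∈ Y := by
    intro i hi
    simp only [hy, hi, dite_true]
    exact Y.orderEmbOfFin_mem rfl _
  have hex : ∀ i, ∃ q a b : ℤ, i < Y.card →
      Q ≤ q ∧ (q : ℝ) < 2 * Q ∧ (a : ℝ) = q * y i ∧ |(b : ℝ) - q * h (y i)| ≤ δ := by
    intro i
    by_cases hi : i < Y.card
    · obtain ⟨q, a, b, H⟩ := (hY _ (hmem i hi)).2.2
      exact ⟨q, a, b, fun _ => H⟩
    · exact ⟨0, 0, 0, fun h => absurd h hi⟩
  choose q a b H using hex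
  refine ⟨y, q, a, b, ?_, fun i hi => (hY _ (hmem i hi)).1, fun i hi => (hY _ (hmem i hi)).2.1,
    fun i hi => (H i hi).1, fun i hi => (H i hi).2.1, fun i hi => (H i hi).2.2.1,
    fun i hi => (H i hi).2.2.2⟩
  intro i j hij hj
  simp only [hy, hij.trans hj, hj, dite_true]
  exact (Y.orderEmbOfFin rfl).strictMono hij

namespace NearSeq

variable {A : ℝ} {h h' k k' : ℝ → ℝ} {Q δ x₀ : ℝ} {r : ℕ} {y : ℕ → ℝ} {q a b : ℕ → ℤ}

theorem reflect (S : NearSeq h Q δ x₀ r y q a b) :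
    NearSeq (fun x => h (-x)) Q δ (-(x₀ + 1)) r (fun i => -y (r - 1 - i))
      (fun i => q (r - 1 - i)) (fun i => -a (r - 1 - i)) (fun i => b (r - 1 - i)) where
  lt i j hij hj := neg_lt_neg (S.lt _ _ (by omega) (by omega))
  ge i hi := neg_le_neg (S.le _ (by omega))
  le i hi := by
    have := S.ge (r - 1 - i) (by omega)
    linarith
  q_ge i hi := S.q_ge _ (by omega)
  q_lt i hi := S.q_lt _ (by omega)
  a_eq i hi := by
    have := S.a_eq (r - 1 - i) (by omega)
    push_cast
    linarith
  near i hi := by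
    simp only [neg_neg]
    exact S.near _ (by omega)

/-- The determinant of three consecutive integer vectors. -/
def tripleDet (q a b : ℕ → ℤ) (i : ℕ) : ℤ :=
  (q i * a (i + 1) - q (i + 1) * a i) * b (i + 2)
    - (q i * b (i + 1) - q (i + 1) * b i) * a (i + 2)
    + (a i * b (i + 1) - a (i + 1) * b i) * q (i + 2)

theorem tripleDet_le (S : NearSeq h Q δ x₀ r y q a b) (H : LegendrePair A h h' k k')
    (hA : 1 ≤ A) (hQ : 0 < Q) (hδ : 0 ≤ δ) {i : ℕ} (hi : i + 2 < r) :
    |(tripleDet q a b i : ℝ)| ≤ 4 * A * (Q * (y (i + 2) - y i)) ^ 3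
      + 8 * δ * Q ^ 2 * (y (i + 2) - y i) := by
  have l1 : y i ≤ y (i + 1) := S.mono (Nat.le_succ i) (by omega)
  have l2 : y (i + 1) ≤ y (i + 2) := S.mono (Nat.le_succ (i + 1)) hi
  have hd := H.det_le hA l1 l2
  have a0 := S.a_eq i (by omega)
  have a1 := S.a_eq (i + 1) (by omega)
  have a2 := S.a_eq (i + 2) hi
  have n0 := S.near i (by omega)
  have n1 := S.near (i + 1) (by omega)
  have n2 := S.near (i + 2) hi
  have q0 := S.q_ge i (by omega)
  have q1 := S.q_ge (i + 1) (by omega)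
  have q2 := S.q_ge (i + 2) hi
  have Q0 := S.q_lt i (by omega)
  have Q1 := S.q_lt (i + 1) (by omega)
  have Q2 := S.q_lt (i + 2) hi
  set d := (y (i + 1) - y i) * (h (y (i + 2)) - h (y i))
    - (y (i + 2) - y i) * (h (y (i + 1)) - h (y i)) with hdd
  have e : (tripleDet q a b i : ℝ) = q i * q (i + 1) * q (i + 2) * d
      + (b (i + 2) - q (i + 2) * h (y (i + 2))) * (q i * q (i + 1) * (y (i + 1) - y i))
      - (b (i + 1) - q (i + 1) * h (y (i + 1))) * (q i * q (i + 2) * (y (i + 2) - y i))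
      + (b i - q i * h (y i)) * (q (i + 1) * q (i + 2) * (y (i + 2) - y (i + 1))) := by
    unfold tripleDet
    push_cast
    rw [a0, a1, a2, hdd]
    ring
  have hprod : ∀ u v : ℝ, Q ≤ u → u < 2 * Q → Q ≤ v → v < 2 * Q → 0 ≤ u * v ∧ u * v ≤ 4 * Q ^ 2 := by
    intro u v hu hu' hv hv'
    constructor
    · exact mul_nonneg (by linarith) (by linarith)
    · nlinarith
  have hterm : ∀ u v e s : ℝ, Q ≤ u → u < 2 * Q → Q ≤ v → v < 2 * Q → |e| ≤ δ → 0 ≤ s →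
      |e * (u * v * s)| ≤ δ * (4 * Q ^ 2 * s) := by
    intro u v e s hu hu' hv hv' he hs
    obtain ⟨p1, p2⟩ := hprod u v hu hu' hv hv'
    rw [abs_mul, abs_of_nonneg (mul_nonneg p1 hs)]
    exact mul_le_mul he (mul_le_mul_of_nonneg_right p2 hs) (mul_nonneg p1 hs) hδ
  have t2 := hterm _ _ _ _ q0 Q0 q1 Q1 n2 (sub_nonneg.2 l1)
  have t1 := hterm _ _ _ _ q0 Q0 q2 Q2 n1 (sub_nonneg.2 (l1.trans l2))
  have t0 := hterm _ _ _ _ q1 Q1 q2 Q2 n0 (sub_nonneg.2 l2)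
  have t3 : |(q i : ℝ) * q (i + 1) * q (i + 2) * d|
      ≤ 8 * Q ^ 3 * (A * (y (i + 2) - y i) ^ 3 / 2) := by
    obtain ⟨p1, p2⟩ := hprod _ _ q0 Q0 q1 Q1
    have p3 : (0 : ℝ) ≤ q (i + 2) := by linarith
    rw [abs_mul, abs_of_nonneg (mul_nonneg p1 p3)]
    refine mul_le_mul ?_ hd (abs_nonneg _) (by positivity)
    calc (q i : ℝ) * q (i + 1) * q (i + 2) ≤ 4 * Q ^ 2 * (2 * Q) :=
          mul_le_mul p2 Q2.le p3 (by positivity)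
      _ = 8 * Q ^ 3 := by ring
  rw [e]
  rw [abs_le] at t0 t1 t2 t3 ⊢
  constructor <;> linarith

theorem card_tripleDet_le (S : NearSeq h Q δ x₀ r y q a b) (H : LegendrePair A h h' k k')
    (hA : 1 ≤ A) (hQ : 0 < Q) (hδ : 0 ≤ δ) {T : Finset ℕ}
    (hT : ∀ i ∈ T, i + 2 < r ∧ tripleDet q a b i ≠ 0) :
    (T.card : ℝ) ≤ 32 * A * (Q + δ * Q ^ 2) := by
  set G := 16 * A * (Q + δ * Q ^ 2) with hG
  have hG0 : 0 < G := by positivity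
  have hgap : ∀ i ∈ T, 1 ≤ G * (y (i + 2) - y i) := by
    intro i hi
    obtain ⟨hr, hne⟩ := hT i hi
    have h1 : (1 : ℝ) ≤ |(tripleDet q a b i : ℝ)| := by exact_mod_cast Int.one_le_abs hne
    have h2 := S.tripleDet_le H hA hQ hδ hr
    have h0 : 0 ≤ y (i + 2) - y i := sub_nonneg.2 (S.mono (by omega) hr)
    set s := y (i + 2) - y i
    by_contra! hcon
    have e1 : 16 * A * (Q * s) < 1 := by
      have : 0 ≤ A * (δ * Q ^ 2 * s) := by positivity
      nlinarith
    have e2 : 16 * A * (δ * Q ^ 2 * s) < 1 := by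
      have : 0 ≤ A * (Q * s) := by positivity
      nlinarith
    have hs : 0 ≤ Q * s := by positivity
    have hs1 : Q * s < 1 / 16 := by nlinarith
    have e3 : 4 * A * (Q * s) ^ 3 ≤ 1 / 4 := by
      have : (Q * s) ^ 2 ≤ 1 := by nlinarith
      nlinarith [mul_nonneg (by linarith : 0 ≤ A) hs]
    have e4 : 0 ≤ δ * Q ^ 2 * s := by positivity
    nlinarith
  have hs1 := S.sum_gap_le_one (T := T) (fun i hi => by have := (hT i hi).1; omega)
  have hs2 := S.sum_gap_le_one (T := T.map (addRightEmbedding 1)) (fun i hi => by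
    obtain ⟨j, hj, rfl⟩ := Finset.mem_map.1 hi
    have := (hT j hj).1
    simp only [addRightEmbedding_apply]
    omega)
  rw [Finset.sum_map] at hs2
  simp only [addRightEmbedding_apply, add_assoc, Nat.reduceAdd] at hs2
  calc (T.card : ℝ) = ∑ i ∈ T, (1 : ℝ) := by simp
    _ ≤ ∑ i ∈ T, G * ((y (i + 1) - y i) + (y (i + 2) - y (i + 1))) := by
        apply Finset.sum_le_sum
        intro i hi
        have := hgap i hi
        rwa [show (y (i + 1) - y i) + (y (i + 2) - y (i + 1)) = y (i + 2) - y i by ring]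
    _ = G * (∑ i ∈ T, (y (i + 1) - y i) + ∑ i ∈ T, (y (i + 2) - y (i + 1))) := by
        rw [← Finset.mul_sum, Finset.sum_add_distrib]
    _ ≤ G * 2 := by gcongr; linarith
    _ = 32 * A * (Q + δ * Q ^ 2) := by rw [hG]; ring

/-- Bound for the number of consecutive pairs lying on a plane of small size whose point of
tangency lies to the left. -/
theorem card_right_le (S : NearSeq h Q δ x₀ r y q a b) (H : LegendrePair A h h' k k')
    (hA : 1 ≤ A) (hQ : 1 ≤ Q) (hδ : 0 ≤ δ) {c D : ℝ} (hc : 0 < c) (hc4 : c ≤ 1 / 4)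
    (hDδ : D * δ ≤ c ^ 2) (hDQ : D ≤ c ^ 2 * Q) {K : ℕ} (hDK : D ≤ 2 ^ K) {B : ℕ → ℝ}
    (hB : ∀ m < K, CountBound A (2 ^ m) (c ^ 2 / 2 ^ m) (B m)) {T : Finset ℕ}
    {n : ℕ → ℤ × ℤ × ℤ} (hR : ∀ i ∈ T, S.RightPlane k' D (n i) i) :
    (T.card : ℝ) ≤ 16 / c * (δ * Q ^ 2) + 8 * √A * √(δ * Q ^ 3)
      + 8 * √A * √(δ * Q ^ 3) * ((⌈A * (1 + A)⌉₊ + 1 : ℕ) : ℝ) *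
      ∑ m ∈ Finset.range K, B m / 2 ^ m := by
  set p : ℕ → Prop := fun i => planeVal h (n i) (k' ((n i).2.1 / (n i).1)) < -(c / Q)
  have h1 := S.card_transversal_le H hA (by linarith) hδ hc hc4 hDδ (T := T.filter p) (n := n)
    (fun i hi => hR i (Finset.mem_filter.1 hi).1) (fun i hi => (Finset.mem_filter.1 hi).2)
  have h2 := S.card_tangential_le H hA hQ hδ hc hc4 hDδ hDQ hDK hB
    (T := T.filter (fun i => ¬ p i)) (n := n)
    (fun i hi => hR i (Finset.mem_filter.1 hi).1)
    (fun i hi => not_lt.1 (Finset.mem_filter.1 hi).2)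
  have h3 : (T.card : ℝ) = (T.filter p).card + (T.filter (fun i => ¬ p i)).card := by
    exact_mod_cast (Finset.card_filter_add_card_filter_not (s := T) p).symm
  linarith

end NearSeq

namespace NearSeq

variable {A : ℝ} {h h' k k' : ℝ → ℝ} {Q δ x₀ : ℝ} {r : ℕ} {y : ℕ → ℝ} {q a b : ℕ → ℤ}

theorem exists_planes (S : NearSeq h Q δ x₀ r y q a b) (hQ : 0 < Q) :
    ∃ n : ℕ → ℤ × ℤ × ℤ, ∀ i, i + 1 < r → IsPrimitive (n i) ∧ 0 < (n i).1 ∧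
      OnPlane (n i) (q i) (a i) (b i) ∧ OnPlane (n i) (q (i + 1)) (a (i + 1)) (b (i + 1)) ∧
      (tripleDet q a b i = 0 → OnPlane (n i) (q (i + 2)) (a (i + 2)) (b (i + 2))) := by
  have hex : ∀ i, ∃ n : ℤ × ℤ × ℤ, i + 1 < r → IsPrimitive n ∧ 0 < n.1 ∧
      OnPlane n (q i) (a i) (b i) ∧ OnPlane n (q (i + 1)) (a (i + 1)) (b (i + 1)) ∧
      (tripleDet q a b i = 0 → OnPlane n (q (i + 2)) (a (i + 2)) (b (i + 2))) := by
    intro i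
    by_cases hi : i + 1 < r
    · obtain ⟨n, h1, h2, h3, h4, h5⟩ := exists_plane (b := b i) (b' := b (i + 1))
        (S.det_pos hQ (Nat.lt_succ_self i) hi).1
      exact ⟨n, fun _ => ⟨h1, h2, h3, h4, h5 _ _ _⟩⟩
    · exact ⟨0, fun h => absurd h hi⟩
  choose n hn using hex
  exact ⟨n, hn⟩

theorem card_large_plane_le (S : NearSeq h Q δ x₀ r y q a b) (hQ : 0 < Q) {D : ℝ} {T : Finset ℕ}
    {n : ℕ → ℤ × ℤ × ℤ} (hT : ∀ i ∈ T, i + 1 < r ∧ D ≤ (n i).1 ∧ IsPrimitive (n i) ∧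
      OnPlane (n i) (q i) (a i) (b i) ∧ OnPlane (n i) (q (i + 1)) (a (i + 1)) (b (i + 1))) :
    D * T.card ≤ 4 * Q ^ 2 := by
  have h1 := S.sum_gap_le_one (T := T) (fun i hi => (hT i hi).1)
  calc D * T.card = ∑ i ∈ T, D := by rw [Finset.sum_const, nsmul_eq_mul, mul_comm]
    _ ≤ ∑ i ∈ T, 4 * Q ^ 2 * (y (i + 1) - y i) := by
        apply Finset.sum_le_sum
        intro i hi
        obtain ⟨hr, hD, hp, o1, o2⟩ := hT i hi
        exact hD.trans (S.normal_le hQ hp (Nat.lt_succ_self i) hr o1 o2)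
    _ = 4 * Q ^ 2 * ∑ i ∈ T, (y (i + 1) - y i) := by rw [Finset.mul_sum]
    _ ≤ 4 * Q ^ 2 := mul_le_of_le_one_right (by positivity) h1

theorem length_le (S : NearSeq h Q δ x₀ r y q a b) (H : LegendrePair A h h' k k')
    (hA : 1 ≤ A) (hQ : 1 ≤ Q) (hδ : 0 < δ) {c : ℝ} (hc : 0 < c) (hc4 : c ≤ 1 / 4)
    {K : ℕ} (hK : c ^ 2 * min (1 / δ) Q ≤ 2 ^ K) {B : ℕ → ℝ}
    (hB : ∀ m < K, CountBound A (2 ^ m) (c ^ 2 / 2 ^ m) (B m)) :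
    (r : ℝ) ≤ (2 + 56 * A + 4 / c ^ 2 + 48 / c) * (Q + δ * Q ^ 2)
      + 24 * √A * ((⌈A * (1 + A)⌉₊ + 1 : ℕ) : ℝ) * √(δ * Q ^ 3) *
      ∑ m ∈ Finset.range K, B m / 2 ^ m := by
  have hQ0 : 0 < Q := by linarith
  set D := c ^ 2 * min (1 / δ) Q with hD
  have hmin : 0 < min (1 / δ) Q := by positivity
  have hD0 : 0 < D := by positivity
  have hDδ : D * δ ≤ c ^ 2 := by
    have : min (1 / δ) Q * δ ≤ 1 := by
      calc min (1 / δ) Q * δ ≤ 1 / δ * δ := by gcongr; exact min_le_left _ _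
        _ = 1 := by field_simp
    rw [hD, mul_assoc]
    exact mul_le_of_le_one_right (by positivity) this
  have hDQ : D ≤ c ^ 2 * Q := by
    rw [hD]; gcongr; exact min_le_right _ _
  obtain ⟨n, hn⟩ := S.exists_planes hQ0
  set E := 16 / c * (δ * Q ^ 2) + 8 * √A * √(δ * Q ^ 3)
      + 8 * √A * √(δ * Q ^ 3) * ((⌈A * (1 + A)⌉₊ + 1 : ℕ) : ℝ) *
      ∑ m ∈ Finset.range K, B m / 2 ^ m with hE
  set U := Finset.range (r - 2) with hU
  set TA := U.filter (fun i => tripleDet q a b i ≠ 0) with hTA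
  set TB := U.filter (fun i => D ≤ (n i).1) with hTB
  set TR := (Finset.range (r - 1)).filter
    (fun i => ((n i).1 : ℝ) < D ∧ k' ((n i).2.1 / (n i).1) ≤ y i) with hTR
  set TL := U.filter
    (fun i => ((n i).1 : ℝ) < D ∧ y (i + 1) ≤ k' ((n i).2.1 / (n i).1)) with hTL
  set TS := U.filter (fun i => i + 1 ∈ TR) with hTS
  have cA : (TA.card : ℝ) ≤ 32 * A * (Q + δ * Q ^ 2) := by
    refine S.card_tripleDet_le H hA hQ0 hδ.le fun i hi => ?_
    rw [hTA, hU, Finset.mem_filter, Finset.mem_range] at hi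
    exact ⟨by omega, hi.2⟩
  have cB : (TB.card : ℝ) ≤ 4 / c ^ 2 * (Q + δ * Q ^ 2) := by
    have h1 : D * TB.card ≤ 4 * Q ^ 2 := by
      refine S.card_large_plane_le hQ0 (n := n) fun i hi => ?_
      rw [hTB, hU, Finset.mem_filter, Finset.mem_range] at hi
      have hr : i + 1 < r := by omega
      obtain ⟨p1, p2, p3, p4, -⟩ := hn i hr
      exact ⟨hr, hi.2, p1, p3, p4⟩
    have h2 : Q ^ 2 ≤ min (1 / δ) Q * (Q + δ * Q ^ 2) := by
      rcases min_cases (1 / δ) Q with ⟨e, -⟩ | ⟨e, -⟩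
      · rw [e]
        have : 1 / δ * (Q + δ * Q ^ 2) = Q / δ + Q ^ 2 := by field_simp
        rw [this]
        have : 0 ≤ Q / δ := by positivity
        linarith
      · rw [e]
        have : 0 ≤ Q * (δ * Q ^ 2) := by positivity
        nlinarith
    refine le_of_mul_le_mul_left (h1.trans ?_) hD0
    calc 4 * Q ^ 2 ≤ 4 * (min (1 / δ) Q * (Q + δ * Q ^ 2)) := by gcongr
      _ = D * (4 / c ^ 2 * (Q + δ * Q ^ 2)) := by rw [hD]; field_simp
  have cR : (TR.card : ℝ) ≤ E := by
    refine S.card_right_le H hA hQ hδ.le hc hc4 hDδ hDQ hK hB (n := n) fun i hi => ?_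
    rw [hTR, Finset.mem_filter, Finset.mem_range] at hi
    have hr : i + 1 < r := by omega
    obtain ⟨p1, p2, p3, p4, -⟩ := hn i hr
    exact ⟨p1, p2, hi.2.1, hr, p3, p4, hi.2.2⟩
  have cL : (TL.card : ℝ) ≤ E := by
    have hlt : ∀ i ∈ TL, i + 2 < r := by
      intro i hi
      rw [hTL, hU, Finset.mem_filter, Finset.mem_range] at hi
      omega
    have hinj : Set.InjOn (fun i => r - 2 - i) (TL : Set ℕ) := by
      intro i hi j hj hij
      have := hlt i hi
      have := hlt j hj
      simp only at hij
      omega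
    rw [← Finset.card_image_of_injOn hinj]
    refine S.reflect.card_right_le H.reflect hA hQ hδ.le hc hc4 hDδ hDQ hK hB
      (n := fun i => ((n (r - 2 - i)).1, -(n (r - 2 - i)).2.1, (n (r - 2 - i)).2.2))
      fun j hj => ?_
    obtain ⟨i, hi, rfl⟩ := Finset.mem_image.1 hj
    have hr := hlt i hi
    rw [hTL, Finset.mem_filter] at hi
    obtain ⟨⟨u, v, w, huvw⟩, p2, p3, p4, -⟩ := hn i (by omega)
    have e1 : r - 2 - (r - 2 - i) = i := by omega
    have e2 : r - 1 - (r - 2 - i) = i + 1 := by omega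
    have e3 : r - 1 - (r - 2 - i + 1) = i := by omega
    rw [e1]
    refine ⟨⟨u, -v, w, ?_⟩, p2, hi.2.1, by omega, ?_, ?_, ?_⟩
    · linear_combination huvw
    · simp only [e2]
      unfold OnPlane at p4 ⊢
      linear_combination p4
    · simp only [e3]
      unfold OnPlane at p3 ⊢
      linear_combination p3
    · simp only [e2]
      push_cast
      rw [neg_div, neg_neg]
      exact neg_le_neg hi.2.2
  have cS : (TS.card : ℝ) ≤ E := by
    refine le_trans ?_ cR
    have : TS.card ≤ TR.card := by
      refine Finset.card_le_card_of_injOn (fun i => i + 1)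
        (fun i hi => (Finset.mem_filter.1 hi).2) ?_
      intro i _ j _ hij
      simpa using hij
    exact_mod_cast this
  have hcover : U ⊆ TA ∪ TB ∪ TR ∪ TL ∪ TS := by
    intro i hi
    have hi' := hi
    rw [hU, Finset.mem_range] at hi'
    simp only [Finset.mem_union]
    by_cases h1 : tripleDet q a b i = 0
    swap
    · exact Or.inl (Or.inl (Or.inl (Or.inl (Finset.mem_filter.2 ⟨hi, h1⟩))))
    by_cases h2 : D ≤ (n i).1
    · exact Or.inl (Or.inl (Or.inl (Or.inr (Finset.mem_filter.2 ⟨hi, h2⟩))))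
    rw [not_le] at h2
    by_cases h3 : k' ((n i).2.1 / (n i).1) ≤ y i
    · exact Or.inl (Or.inl (Or.inr (Finset.mem_filter.2
        ⟨Finset.mem_range.2 (by omega), h2, h3⟩)))
    by_cases h4 : y (i + 1) ≤ k' ((n i).2.1 / (n i).1)
    · exact Or.inl (Or.inr (Finset.mem_filter.2 ⟨hi, h2, h4⟩))
    refine Or.inr (Finset.mem_filter.2 ⟨hi, Finset.mem_filter.2
      ⟨Finset.mem_range.2 (by omega), ?_⟩⟩)
    obtain ⟨p1, p2, p3, p4, p5⟩ := hn i (by omega)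
    obtain ⟨r1, r2, r3, r4, -⟩ := hn (i + 1) (by omega)
    have e : n i = n (i + 1) := OnPlane.unique p1 r1 p2 r2 p4 (p5 h1) r3 r4
      (S.det_pos hQ0 (Nat.lt_succ_self (i + 1)) (by omega)).1.ne'
    rw [← e]
    exact ⟨h2, (not_le.1 h4).le⟩
  have hcard : (U.card : ℝ) ≤ TA.card + TB.card + TR.card + TL.card + TS.card := by
    have h1 := Finset.card_le_card hcover
    have h2 := Finset.card_union_le (TA ∪ TB ∪ TR ∪ TL) TS
    have h3 := Finset.card_union_le (TA ∪ TB ∪ TR) TL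
    have h4 := Finset.card_union_le (TA ∪ TB) TR
    have h5 := Finset.card_union_le TA TB
    have : U.card ≤ TA.card + TB.card + TR.card + TL.card + TS.card := by omega
    exact_mod_cast this
  have hr : (r : ℝ) ≤ U.card + 2 := by
    rw [hU, Finset.card_range]
    have : r ≤ (r - 2) + 2 := by omega
    exact_mod_cast this
  have hsq : √(δ * Q ^ 3) ≤ Q + δ * Q ^ 2 := by
    have h0 : 0 ≤ δ * Q ^ 2 := by positivity
    apply Real.sqrt_le_iff.2 ⟨by positivity, ?_⟩
    nlinarith [mul_nonneg hQ0.le h0]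
  have hsA : √A ≤ A := by
    apply Real.sqrt_le_iff.2 ⟨by linarith, ?_⟩
    nlinarith
  have hW : √A * √(δ * Q ^ 3) ≤ A * (Q + δ * Q ^ 2) := by gcongr
  have h16 : 16 / c * (δ * Q ^ 2) ≤ 16 / c * (Q + δ * Q ^ 2) := by gcongr; linarith
  have h2 : 2 ≤ 2 * (Q + δ * Q ^ 2) := by
    have h0 : 0 ≤ δ * Q ^ 2 := by positivity
    linarith
  have e48 : 48 / c = 3 * (16 / c) := by ring
  rw [e48]
  rw [hE] at cR cL cS
  linarith

end NearSeq

theorem CountBound.step {A Q δ c : ℝ} (hA : 1 ≤ A) (hQ : 1 ≤ Q) (hδ : 0 < δ) (hc : 0 < c)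
    (hc4 : c ≤ 1 / 4) {K : ℕ} (hK : c ^ 2 * min (1 / δ) Q ≤ 2 ^ K) {B : ℕ → ℝ}
    (hB : ∀ m < K, CountBound A (2 ^ m) (c ^ 2 / 2 ^ m) (B m)) :
    CountBound A Q δ ((2 + 56 * A + 4 / c ^ 2 + 48 / c) * (Q + δ * Q ^ 2)
      + 24 * √A * ((⌈A * (1 + A)⌉₊ + 1 : ℕ) : ℝ) * √(δ * Q ^ 3) *
      ∑ m ∈ Finset.range K, B m / 2 ^ m) := by
  intro h h' k k' H x₀ Y hY
  obtain ⟨y, q, a, b, S⟩ := exists_nearSeq hY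
  exact S.length_le H hA hQ hδ hc hc4 hK hB

theorem geom_sum_le_div {x : ℝ} (hx : 1 < x) (m : ℕ) :
    ∑ j ∈ Finset.range m, x ^ j ≤ x ^ m / (x - 1) := by
  rw [geom_sum_eq hx.ne']
  have : 0 < x - 1 := by linarith
  gcongr
  linarith

theorem exists_countBound_self_dual {A x : ℝ} (hA : 1 ≤ A) (hx : 1 < x) :
    ∃ c K : ℝ, 0 < c ∧ c ≤ 1 / 4 ∧ 0 < K ∧
      ∀ m : ℕ, CountBound A (2 ^ m) (c ^ 2 / 2 ^ m) (K * 2 ^ m * x ^ m) := by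
  set CA := 24 * √A * ((⌈A * (1 + A)⌉₊ + 1 : ℕ) : ℝ) with hCA
  have hCA0 : 0 < CA := by positivity
  have hx1 : 0 < x - 1 := by linarith
  set c := min (1 / 4) ((x - 1) / (2 * CA)) with hc
  have hc0 : 0 < c := by positivity
  have hc4 : c ≤ 1 / 4 := min_le_left _ _
  have hcx : CA * c ≤ (x - 1) / 2 := by
    calc CA * c ≤ CA * ((x - 1) / (2 * CA)) := by gcongr; exact min_le_right _ _
      _ = (x - 1) / 2 := by field_simp
  set C1 := 2 + 56 * A + 4 / c ^ 2 + 48 / c with hC1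
  have hC10 : 0 < C1 := by positivity
  refine ⟨c, 4 * C1, hc0, hc4, by positivity, fun m => ?_⟩
  induction m using Nat.strong_induction_on with
  | _ m ih =>
    have hp : (1 : ℝ) ≤ 2 ^ m := one_le_pow₀ (by norm_num)
    have hxm : 1 ≤ x ^ m := one_le_pow₀ hx.le
    have hc1 : c ^ 2 ≤ 1 := by nlinarith
    have hK : c ^ 2 * min (1 / (c ^ 2 / 2 ^ m)) (2 ^ m) ≤ (2 : ℝ) ^ m := by
      calc c ^ 2 * min (1 / (c ^ 2 / 2 ^ m)) (2 ^ m) ≤ 1 * (2 : ℝ) ^ m := by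
            gcongr; exact min_le_right _ _
        _ = 2 ^ m := one_mul _
    refine (CountBound.step hA hp (by positivity) hc0 hc4 hK ih).mono ?_
    rw [← hCA, ← hC1]
    have e1 : √(c ^ 2 / 2 ^ m * (2 ^ m) ^ 3) = c * 2 ^ m := by
      rw [show c ^ 2 / 2 ^ m * ((2 : ℝ) ^ m) ^ 3 = (c * 2 ^ m) ^ 2 by field_simp]
      exact Real.sqrt_sq (by positivity)
    have e2 : (2 : ℝ) ^ m + c ^ 2 / 2 ^ m * (2 ^ m) ^ 2 = 2 ^ m * (1 + c ^ 2) := by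
      field_simp
    have e3 : ∑ j ∈ Finset.range m, 4 * C1 * 2 ^ j * x ^ j / 2 ^ j
        = 4 * C1 * ∑ j ∈ Finset.range m, x ^ j := by
      rw [Finset.mul_sum]
      exact Finset.sum_congr rfl fun j _ => by field_simp
    rw [e1, e2, e3]
    calc C1 * (2 ^ m * (1 + c ^ 2)) + CA * (c * 2 ^ m) * (4 * C1 * ∑ j ∈ Finset.range m, x ^ j)
        ≤ C1 * (2 ^ m * (1 + 1)) + CA * (c * 2 ^ m) * (4 * C1 * (x ^ m / (x - 1))) := by
          gcongr
          exact geom_sum_le_div hx m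
      _ = 2 * C1 * 2 ^ m * 1 + 4 * C1 * 2 ^ m * x ^ m * (CA * c / (x - 1)) := by ring
      _ ≤ 2 * C1 * 2 ^ m * x ^ m + 4 * C1 * 2 ^ m * x ^ m * (1 / 2) := by
          have : CA * c / (x - 1) ≤ 1 / 2 := by
            rw [div_le_div_iff₀ hx1 (by norm_num)]
            linarith
          gcongr
      _ = 4 * C1 * 2 ^ m * x ^ m := by ring

theorem exists_countBound {A θ : ℝ} (hA : 1 ≤ A) (hθ : 0 < θ) :
    ∃ K : ℝ, 0 < K ∧ ∀ Q δ : ℝ, 1 ≤ Q → 0 < δ → δ ≤ 1 →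
      CountBound A Q δ (K * (Q + δ ^ (1 - θ) * Q ^ 2)) := by
  set x : ℝ := 2 ^ (θ / 2) with hx
  have hx1 : 1 < x := Real.one_lt_rpow (by norm_num) (by positivity)
  have hx0 : 0 < x - 1 := by linarith
  obtain ⟨c, K, hc, hc4, hK, hB⟩ := exists_countBound_self_dual hA hx1
  set CA := 24 * √A * ((⌈A * (1 + A)⌉₊ + 1 : ℕ) : ℝ) with hCA
  set C1 := 2 + 56 * A + 4 / c ^ 2 + 48 / c with hC1
  have hCA0 : 0 < CA := by positivity
  have hC10 : 0 < C1 := by positivity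
  refine ⟨C1 + CA * (K * (x / (x - 1))), by positivity, fun Q δ hQ hδ hδ1 => ?_⟩
  have hQ0 : 0 < Q := by linarith
  set μ := min (1 / δ) Q with hμ
  have hμ1 : 1 ≤ μ := le_min ((one_le_div hδ).2 hδ1) hQ
  obtain ⟨n, hn1, hn2⟩ := exists_nat_pow_near hμ1 (one_lt_two)
  have hKn : c ^ 2 * μ ≤ 2 ^ (n + 1) := by
    have : c ^ 2 ≤ 1 := by nlinarith
    nlinarith
  refine (CountBound.step hA hQ hδ hc hc4 hKn (fun m _ => hB m)).mono ?_
  rw [← hCA, ← hC1]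
  have e3 : ∑ j ∈ Finset.range (n + 1), K * 2 ^ j * x ^ j / 2 ^ j
      = K * ∑ j ∈ Finset.range (n + 1), x ^ j := by
    rw [Finset.mul_sum]
    exact Finset.sum_congr rfl fun j _ => by field_simp
  have hxn : x ^ n ≤ μ ^ (θ / 2) := by
    calc x ^ n = ((2 : ℝ) ^ n) ^ (θ / 2) := by
          rw [hx, ← Real.rpow_natCast, ← Real.rpow_natCast, ← Real.rpow_mul (by norm_num),
            ← Real.rpow_mul (by norm_num), mul_comm]
      _ ≤ μ ^ (θ / 2) := by gcongr
  have hsum : ∑ j ∈ Finset.range (n + 1), x ^ j ≤ x / (x - 1) * μ ^ (θ / 2) := by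
    refine (geom_sum_le_div hx1 _).trans ?_
    rw [pow_succ, div_mul_eq_mul_div, mul_comm]
    gcongr
  have hδθ : δ * (1 / δ) ^ θ = δ ^ (1 - θ) := by
    rw [Real.rpow_sub hδ, Real.rpow_one, one_div, Real.inv_rpow hδ.le]
    rfl
  have hpow : δ ≤ δ ^ (1 - θ) := by
    calc δ = δ ^ (1 : ℝ) := (Real.rpow_one δ).symm
      _ ≤ δ ^ (1 - θ) := Real.rpow_le_rpow_of_exponent_ge hδ hδ1 (by linarith)
  have hP : 0 ≤ δ ^ (1 - θ) * Q ^ 2 := by positivity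
  have hmain : √(δ * Q ^ 3) * μ ^ (θ / 2) ≤ Q + δ ^ (1 - θ) * Q ^ 2 := by
    refine (pow_le_pow_iff_left₀ (by positivity) (by positivity) two_ne_zero).1 ?_
    have e : (μ ^ (θ / 2)) ^ 2 = μ ^ θ := by
      rw [← Real.rpow_natCast, ← Real.rpow_mul (by linarith)]
      norm_num
    have : μ ^ θ ≤ (1 / δ) ^ θ := by gcongr; exact min_le_left _ _
    rw [mul_pow, Real.sq_sqrt (by positivity), e]
    calc δ * Q ^ 3 * μ ^ θ ≤ δ * Q ^ 3 * (1 / δ) ^ θ := by gcongr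
      _ = (δ * (1 / δ) ^ θ) * Q ^ 2 * Q := by ring
      _ = (δ ^ (1 - θ) * Q ^ 2) * Q := by rw [hδθ]
      _ ≤ (Q + δ ^ (1 - θ) * Q ^ 2) ^ 2 := by nlinarith [mul_nonneg hP hQ0.le]
  rw [e3]
  calc C1 * (Q + δ * Q ^ 2) + CA * √(δ * Q ^ 3) * (K * ∑ j ∈ Finset.range (n + 1), x ^ j)
      ≤ C1 * (Q + δ ^ (1 - θ) * Q ^ 2)
        + CA * √(δ * Q ^ 3) * (K * (x / (x - 1) * μ ^ (θ / 2))) := by gcongr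
    _ = C1 * (Q + δ ^ (1 - θ) * Q ^ 2)
        + CA * (K * (x / (x - 1))) * (√(δ * Q ^ 3) * μ ^ (θ / 2)) := by ring
    _ ≤ C1 * (Q + δ ^ (1 - θ) * Q ^ 2)
        + CA * (K * (x / (x - 1))) * (Q + δ ^ (1 - θ) * Q ^ 2) := by gcongr
    _ = _ := by ring

theorem sum_inv_den_le {Q x₀ : ℝ} (hQ : 0 ≤ Q) {V : Finset ℚ}
    (hV : ∀ ρ ∈ V, (ρ.den : ℝ) ≤ 2 * Q ∧ x₀ ≤ ρ ∧ (ρ : ℝ) ≤ x₀ + 1) :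
    ∑ ρ ∈ V, (1 : ℝ) / ρ.den ≤ 4 * Q := by
  set N := ⌊2 * Q⌋₊
  have hmaps : ∀ ρ ∈ V, ρ.den ∈ Finset.Icc 1 N := fun ρ hρ =>
    Finset.mem_Icc.2 ⟨ρ.pos, Nat.le_floor (hV ρ hρ).1⟩
  have hblock : ∀ d ∈ Finset.Icc 1 N, ((V.filter (fun ρ => ρ.den = d)).card : ℝ) ≤ 2 * d := by
    intro d hd
    have hd1 := (Finset.mem_Icc.1 hd).1
    have h1 : (V.filter (fun ρ => ρ.den = d)).card ≤
        (Finset.Icc (0 : ℤ) d).card := by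
      refine Finset.card_le_card_of_injOn (fun ρ => ρ.num - ⌈(d : ℝ) * x₀⌉) ?_ ?_
      · intro ρ hρ
        obtain ⟨hρV, hden⟩ := Finset.mem_filter.1 hρ
        obtain ⟨-, l, u⟩ := hV ρ hρV
        have hd0 : (0 : ℝ) < d := by exact_mod_cast hd1
        have e : (ρ : ℝ) = ρ.num / d := by rw [← hden]; exact Rat.cast_def ρ
        rw [e, le_div_iff₀ hd0] at l
        rw [e, div_le_iff₀ hd0] at u
        have c1 : ⌈(d : ℝ) * x₀⌉ ≤ ρ.num := Int.ceil_le.2 (by linarith)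
        have c2 : ρ.num - d ≤ ⌈(d : ℝ) * x₀⌉ := by
          have : ((ρ.num - d : ℤ) : ℝ) ≤ ⌈(d : ℝ) * x₀⌉ := by
            push_cast
            linarith [Int.le_ceil ((d : ℝ) * x₀)]
          exact_mod_cast this
        rw [Finset.mem_coe, Finset.mem_Icc]
        constructor <;> linarith
      · intro ρ hρ σ hσ e
        have e1 := (Finset.mem_filter.1 hρ).2
        have e2 := (Finset.mem_filter.1 hσ).2
        exact Rat.ext (by simpa using e) (by rw [e1, e2])
    rw [Int.card_Icc] at h1
    have h2 : (V.filter (fun ρ => ρ.den = d)).card ≤ 2 * d := by omega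
    exact_mod_cast h2
  calc ∑ ρ ∈ V, (1 : ℝ) / ρ.den
      = ∑ d ∈ Finset.Icc 1 N, ∑ ρ ∈ V.filter (fun ρ => ρ.den = d), (1 : ℝ) / ρ.den :=
        (Finset.sum_fiberwise_of_maps_to hmaps _).symm
    _ ≤ ∑ d ∈ Finset.Icc 1 N, (2 : ℝ) := by
        apply Finset.sum_le_sum
        intro d hd
        have hd0 : (0 : ℝ) < d := by exact_mod_cast (Finset.mem_Icc.1 hd).1
        have : ∑ ρ ∈ V.filter (fun ρ => ρ.den = d), (1 : ℝ) / ρ.den =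
            (V.filter (fun ρ => ρ.den = d)).card * (1 / d) := by
          rw [← nsmul_eq_mul, ← Finset.sum_const]
          exact Finset.sum_congr rfl fun ρ hρ => by rw [(Finset.mem_filter.1 hρ).2]
        rw [this, mul_one_div, div_le_iff₀ hd0]
        exact hblock d hd
    _ = 2 * N := by simp [mul_comm]
    _ ≤ 4 * Q := by
        have := Nat.floor_le (by positivity : 0 ≤ 2 * Q)
        linarith

/-- Primitive near vectors over a fixed rational number are separated. -/
theorem card_primitive_fiber_le {Q δ κ : ℝ} (hQ : 0 < Q) (hδ : 0 ≤ δ) {ρ : ℚ}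
    {T : Finset (ℤ × ℤ × ℤ)} (hT : ∀ p ∈ T, IsPrimitive p ∧ Q ≤ p.1 ∧ (p.1 : ℝ) < 2 * Q ∧
      (p.2.1 : ℚ) / p.1 = ρ ∧ |(p.2.2 : ℝ) - p.1 * κ| ≤ δ) :
    (T.card : ℝ) ≤ 2 + 8 * δ * Q * (1 / ρ.den) := by
  have hd : (0 : ℝ) < ρ.den := by exact_mod_cast ρ.pos
  set z := 4 * δ * Q / ρ.den with hz
  have hz0 : 0 ≤ z := by positivity
  set u : ℤ × ℤ × ℤ → ℝ := fun p => (p.2.2 / p.1 - κ) * (4 * Q ^ 2 / ρ.den) with hu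
  have hcard : T.card ≤ (Finset.Icc ⌊-z⌋ ⌊z⌋).card := by
    refine Finset.card_le_card_of_injOn (fun p => ⌊u p⌋) ?_ ?_
    · intro p hp
      obtain ⟨-, h1, -, -, h2⟩ := hT p hp
      have hp0 : (0 : ℝ) < p.1 := by linarith
      have e : (p.2.2 / p.1 - κ : ℝ) = (p.2.2 - p.1 * κ) / p.1 := by field_simp
      have h3 : |u p| ≤ z := by
        simp only [hu]
        rw [e, abs_mul, abs_div, abs_of_pos hp0, abs_of_pos (by positivity : 0 < 4 * Q ^ 2 / _)]
        calc |(p.2.2 : ℝ) - p.1 * κ| / p.1 * (4 * Q ^ 2 / ρ.den)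
            ≤ δ / Q * (4 * Q ^ 2 / ρ.den) := by gcongr
          _ = z := by rw [hz]; field_simp
      rw [abs_le] at h3
      rw [Finset.mem_coe, Finset.mem_Icc]
      exact ⟨Int.floor_mono h3.1, Int.floor_mono h3.2⟩
    · intro p hp p' hp' e
      obtain ⟨g, h1, h2, h3, -⟩ := hT p hp
      obtain ⟨g', h1', h2', h3', -⟩ := hT p' hp'
      have hp0 : (0 : ℝ) < p.1 := by linarith
      have hp0' : (0 : ℝ) < p'.1 := by linarith
      have hz0 : 0 < p.1 := by exact_mod_cast hp0
      have hz0' : 0 < p'.1 := by exact_mod_cast hp0'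
      have hq0 : (p.1 : ℚ) ≠ 0 := by exact_mod_cast hz0.ne'
      have hq0' : (p'.1 : ℚ) ≠ 0 := by exact_mod_cast hz0'.ne'
      have hdvd : ∀ s t : ℤ, (s : ℚ) / t = ρ → (ρ.den : ℤ) ∣ t := by
        intro s t hst
        rw [← hst, ← Rat.divInt_eq_div]
        exact Rat.den_dvd s t
      have d1 := hdvd _ _ h3
      have d2 := hdvd _ _ h3'
      have hlt := Int.abs_sub_lt_one_of_floor_eq_floor e
      have e2 : u p - u p' = (p.2.2 * p'.1 - p'.2.2 * p.1) * (4 * Q ^ 2 / (p.1 * p'.1))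
          / ρ.den := by
        simp only [hu]
        field_simp
        ring
      have hge : 1 ≤ 4 * Q ^ 2 / ((p.1 : ℝ) * p'.1) := by
        rw [one_le_div (by positivity)]
        nlinarith
      have hsmall : |(p.2.2 : ℝ) * p'.1 - p'.2.2 * p.1| < ρ.den := by
        rw [e2, abs_div, abs_mul, abs_of_pos hd, div_lt_one hd,
          abs_of_pos (by linarith : 0 < 4 * Q ^ 2 / ((p.1 : ℝ) * p'.1))] at hlt
        exact (le_mul_of_one_le_right (abs_nonneg _) hge).trans_lt hlt
      have hzero : p.2.2 * p'.1 - p'.2.2 * p.1 = 0 := by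
        apply Int.eq_zero_of_abs_lt_dvd (m := ρ.den)
        · exact dvd_sub (Dvd.dvd.mul_left d2 _) (Dvd.dvd.mul_left d1 _)
        · exact_mod_cast hsmall
      refine g.eq_of_ratio g' hz0 hz0' ?_ (by linarith)
      rw [← h3', div_eq_div_iff hq0 hq0'] at h3
      have : (p'.1 : ℚ) * p.2.1 = p.1 * p'.2.1 := by linarith
      exact_mod_cast this
  have hfl : ⌊-z⌋ ≤ ⌊z⌋ := Int.floor_mono (by linarith)
  rw [Int.card_Icc] at hcard
  have h1 : ((⌊z⌋ + 1 - ⌊-z⌋).toNat : ℝ) = ⌊z⌋ + 1 - ⌊-z⌋ := by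
    have := Int.toNat_of_nonneg (by omega : 0 ≤ ⌊z⌋ + 1 - ⌊-z⌋)
    exact_mod_cast this
  have h2 := Int.floor_le z
  have h3 := Int.sub_one_lt_floor (-z)
  have h4 : (T.card : ℝ) ≤ ((⌊z⌋ + 1 - ⌊-z⌋).toNat : ℝ) := by exact_mod_cast hcard
  have h5 : 8 * δ * Q * (1 / ρ.den) = 2 * z := by rw [hz]; ring
  rw [h5]
  linarith

theorem card_primitive_le {A Q δ B : ℝ} (hB : CountBound A Q δ B) {h h' k k' : ℝ → ℝ}
    (H : LegendrePair A h h' k k') (hQ : 0 < Q) (hδ : 0 ≤ δ) {x₀ : ℝ}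
    {T : Finset (ℤ × ℤ × ℤ)} (hT : ∀ p ∈ T, IsPrimitive p ∧ Q ≤ p.1 ∧ (p.1 : ℝ) < 2 * Q ∧
      x₀ ≤ (p.2.1 / p.1 : ℝ) ∧ (p.2.1 / p.1 : ℝ) ≤ x₀ + 1 ∧
      |(p.2.2 : ℝ) - p.1 * h (p.2.1 / p.1)| ≤ δ) :
    (T.card : ℝ) ≤ 2 * B + 32 * δ * Q ^ 2 := by
  set V : Finset ℚ := T.image (fun p => (p.2.1 : ℚ) / p.1) with hV
  have hVB : (V.card : ℝ) ≤ B := by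
    have hinj : Function.Injective (fun ρ : ℚ => (ρ : ℝ)) := Rat.cast_injective
    rw [← Finset.card_image_of_injective V hinj]
    refine hB _ _ _ _ H x₀ _ fun y hy => ?_
    obtain ⟨ρ, hρ, rfl⟩ := Finset.mem_image.1 hy
    obtain ⟨p, hp, rfl⟩ := Finset.mem_image.1 hρ
    obtain ⟨-, h1, h2, h3, h4, h5⟩ := hT p hp
    have hp0 : (0 : ℝ) < p.1 := by linarith
    push_cast
    exact ⟨h3, h4, p.1, p.2.1, p.2.2, h1, h2, by field_simp, h5⟩
  have hfib : ∀ ρ ∈ V, ((T.filter (fun p => (p.2.1 : ℚ) / p.1 = ρ)).card : ℝ) ≤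
      2 + 8 * δ * Q * (1 / ρ.den) := by
    intro ρ _
    refine card_primitive_fiber_le (κ := h ρ) hQ hδ fun p hp => ?_
    obtain ⟨hpT, e⟩ := Finset.mem_filter.1 hp
    obtain ⟨g, h1, h2, -, -, h5⟩ := hT p hpT
    refine ⟨g, h1, h2, e, ?_⟩
    rw [← e]
    push_cast
    exact h5
  have hden : ∑ ρ ∈ V, (1 : ℝ) / ρ.den ≤ 4 * Q := by
    refine sum_inv_den_le (x₀ := x₀) hQ.le fun ρ hρ => ?_
    obtain ⟨p, hp, rfl⟩ := Finset.mem_image.1 hρ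
    obtain ⟨-, h1, h2, h3, h4, -⟩ := hT p hp
    refine ⟨?_, by push_cast; exact h3, by push_cast; exact h4⟩
    have hp0 : (0 : ℝ) < p.1 := by linarith
    have hdvd : ((((p.2.1 : ℚ) / p.1).den : ℕ) : ℤ) ∣ p.1 := by
      rw [← Rat.divInt_eq_div]
      exact Rat.den_dvd _ _
    have := Int.le_of_dvd (by exact_mod_cast hp0) hdvd
    have h6 : ((((p.2.1 : ℚ) / p.1).den : ℕ) : ℝ) ≤ p.1 := by exact_mod_cast this
    linarith
  calc (T.card : ℝ) = ∑ ρ ∈ V, ((T.filter (fun p => (p.2.1 : ℚ) / p.1 = ρ)).card : ℝ) := by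
        rw [← Nat.cast_sum]
        exact congrArg _ (Finset.card_eq_sum_card_image _ T)
    _ ≤ ∑ ρ ∈ V, (2 + 8 * δ * Q * (1 / ρ.den)) := Finset.sum_le_sum hfib
    _ = 2 * V.card + 8 * δ * Q * ∑ ρ ∈ V, (1 : ℝ) / ρ.den := by
        rw [Finset.sum_add_distrib, Finset.sum_const, nsmul_eq_mul, ← Finset.mul_sum, mul_comm]
    _ ≤ 2 * B + 8 * δ * Q * (4 * Q) := by gcongr
    _ = 2 * B + 32 * δ * Q ^ 2 := by ring

theorem sum_inv_Icc_le {x : ℝ} (hx : 1 ≤ x) :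
    ∑ m ∈ Finset.Icc 1 ⌊x⌋₊, (1 : ℝ) / m ≤ 1 + Real.log x := by
  have h1 := harmonic_floor_le_one_add_log x hx
  rw [harmonic_eq_sum_Icc] at h1
  push_cast at h1
  simpa only [one_div] using h1

theorem sum_inv_sq_Icc_le (N : ℕ) : ∑ m ∈ Finset.Icc 1 N, (1 : ℝ) / m ^ 2 ≤ 2 := by
  have h1 := sum_Ioo_inv_sq_le (α := ℝ) 0 (N + 1)
  have h2 : Finset.Ioo 0 (N + 1) = Finset.Icc 1 N := by
    ext m
    simp only [Finset.mem_Ioo, Finset.mem_Icc]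
    omega
  rw [h2] at h1
  simpa using h1

/-- Bound for the number of pairs `(q, a)` in a dyadic block with `q * h (a / q)` close to an
integer. -/
theorem exists_card_pair_le {A θ : ℝ} (hA : 1 ≤ A) (hθ : 0 < θ) (hθ1 : θ ≤ 1) :
    ∃ K : ℝ, 0 < K ∧ ∀ h h' k k' : ℝ → ℝ, LegendrePair A h h' k k' → ∀ Q δ x₀ : ℝ, 1 ≤ Q →
      0 < δ → δ ≤ 1 → ∀ P : Finset (ℤ × ℤ),
      (∀ p ∈ P, Q ≤ p.1 ∧ (p.1 : ℝ) < 2 * Q ∧ x₀ ≤ (p.2 / p.1 : ℝ) ∧ (p.2 / p.1 : ℝ) ≤ x₀ + 1 ∧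
        ∃ b : ℤ, |(b : ℝ) - p.1 * h (p.2 / p.1)| ≤ δ) →
      (P.card : ℝ) ≤ K * (Q * (1 + Real.log Q) + δ ^ (1 - θ) * Q ^ 2) := by
  obtain ⟨K, hK, hB⟩ := exists_countBound hA hθ
  refine ⟨8 * (2 * K + 32), by positivity, fun h h' k k' H Q δ x₀ hQ hδ hδ1 P hP => ?_⟩
  have hQ0 : 0 < Q := by linarith
  have hex : ∀ p : ℤ × ℤ, ∃ (g : ℤ) (n : ℤ × ℤ × ℤ), p ∈ P → 0 < g ∧ IsPrimitive n ∧ 0 < n.1 ∧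
      p.1 = g * n.1 ∧ p.2 = g * n.2.1 ∧
      |(g : ℝ) * n.2.2 - p.1 * h (p.2 / p.1)| ≤ δ := by
    intro p
    by_cases hp : p ∈ P
    · obtain ⟨h1, -, -, -, b, hb⟩ := hP p hp
      have hp0 : 0 < p.1 := by
        have : (0 : ℝ) < p.1 := by linarith
        exact_mod_cast this
      obtain ⟨g, n, g1, g2, g3, g4, g5, g6⟩ := exists_primitive_mul p.1 p.2 b hp0
      refine ⟨g, n, fun _ => ⟨g1, g2, g3, g4, g5, ?_⟩⟩
      rw [g6] at hb
      push_cast at hb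
      exact hb
    · exact ⟨0, 0, fun h => absurd h hp⟩
  choose g n hgn using hex
  set N := ⌊2 * Q⌋₊ with hN
  have hgR : ∀ p ∈ P, (1 : ℝ) ≤ g p ∧ (1 : ℝ) ≤ (n p).1 ∧ (p.1 : ℝ) = g p * (n p).1 ∧
      (p.2 : ℝ) = g p * (n p).2.1 := by
    intro p hp
    obtain ⟨g1, -, g3, g4, g5, -⟩ := hgn p hp
    exact ⟨by exact_mod_cast g1, by exact_mod_cast g3, by exact_mod_cast g4,
      by exact_mod_cast g5⟩
  have hmaps : ∀ p ∈ P, (g p).toNat ∈ Finset.Icc 1 N := by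
    intro p hp
    have h0 := (hgn p hp).1
    obtain ⟨g1, g3, g4, -⟩ := hgR p hp
    have h2 := (hP p hp).2.1
    have h3 : (((g p).toNat : ℕ) : ℝ) = g p := by
      exact_mod_cast Int.toNat_of_nonneg h0.le
    refine Finset.mem_Icc.2 ⟨by omega, Nat.le_floor ?_⟩
    rw [h3]
    nlinarith
  have hblock : ∀ m ∈ Finset.Icc 1 N, ((P.filter (fun p => (g p).toNat = m)).card : ℝ) ≤
      (2 * K + 32) * (2 * Q * (1 / m) + 4 * (δ ^ (1 - θ) * Q ^ 2) * (1 / m ^ 2)) := by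
    intro m hm
    obtain ⟨hm1, hmN⟩ := Finset.mem_Icc.1 hm
    have hm1' : (1 : ℝ) ≤ m := by exact_mod_cast hm1
    have hm0 : (0 : ℝ) < m := by linarith
    have hmQ : (m : ℝ) ≤ 2 * Q :=
      (Nat.cast_le.2 hmN).trans (Nat.floor_le (by linarith))
    set Qm := max 1 (Q / m) with hQm
    have hQm1 : 1 ≤ Qm := le_max_left _ _
    have hQm2 : Qm ≤ 2 * Q / m :=
      max_le ((one_le_div hm0).2 hmQ) (by gcongr; linarith)
    have hδm : 0 < δ / m := by positivity
    have hδm1 : δ / m ≤ 1 := (div_le_self hδ.le hm1').trans hδ1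
    have hgm : ∀ p ∈ P.filter (fun p => (g p).toNat = m), p ∈ P ∧ (g p : ℝ) = m ∧ g p = m := by
      intro p hp
      obtain ⟨hpP, e⟩ := Finset.mem_filter.1 hp
      have h0 := (hgn p hpP).1
      have : g p = m := by omega
      exact ⟨hpP, by exact_mod_cast this, this⟩
    have hinj : Set.InjOn n (P.filter (fun p => (g p).toNat = m) : Finset _) := by
      intro p hp p' hp' e
      obtain ⟨m1, -, m2⟩ := hgm p hp
      obtain ⟨m1', -, m2'⟩ := hgm p' hp'
      obtain ⟨-, -, -, g4, g5, -⟩ := hgn p m1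
      obtain ⟨-, -, -, g4', g5', -⟩ := hgn p' m1'
      exact Prod.ext (by rw [g4, g4', m2, m2', e]) (by rw [g5, g5', m2, m2', e])
    rw [← Finset.card_image_of_injOn hinj]
    have hc := card_primitive_le (hB Qm (δ / m) hQm1 hδm hδm1) H (by linarith) hδm.le (x₀ := x₀)
      (T := (P.filter (fun p => (g p).toNat = m)).image n) (fun v hv => by
        obtain ⟨p, hp, rfl⟩ := Finset.mem_image.1 hv
        obtain ⟨hpP, m1, -⟩ := hgm p hp
        obtain ⟨-, g2, -, -, -, g6⟩ := hgn p hpP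
        obtain ⟨r1, r2, r3, r4⟩ := hgR p hpP
        obtain ⟨h1, h2, h3, h4, -⟩ := hP p hpP
        have hr : (p.2 / p.1 : ℝ) = (n p).2.1 / (n p).1 := by
          rw [r3, r4]
          field_simp
        rw [hr] at h3 h4 g6
        rw [m1] at r3 g6
        rw [r3] at h1 h2 g6
        refine ⟨g2, max_le r2 ?_, ?_, h3, h4, ?_⟩
        · rw [div_le_iff₀ hm0]; linarith
        · have : ((n p).1 : ℝ) < 2 * (Q / m) := by
            rw [← mul_div_assoc, lt_div_iff₀ hm0]; linarith
          linarith [le_max_right 1 (Q / m)]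
        · rw [le_div_iff₀ hm0]
          rw [mul_assoc, ← mul_sub, abs_mul, abs_of_pos hm0] at g6
          linarith)
    refine hc.trans ?_
    have hpw : δ / m ≤ (δ / m) ^ (1 - θ) := by
      calc δ / m = (δ / m) ^ (1 : ℝ) := (Real.rpow_one _).symm
        _ ≤ (δ / m) ^ (1 - θ) := Real.rpow_le_rpow_of_exponent_ge hδm hδm1 (by linarith)
    have hpw2 : (δ / m) ^ (1 - θ) ≤ δ ^ (1 - θ) :=
      Real.rpow_le_rpow hδm.le (div_le_self hδ.le hm1') (by linarith)
    have hpos : 0 < δ ^ (1 - θ) := by positivity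
    have hpos2 : 0 < (δ / m) ^ (1 - θ) := by positivity
    calc 2 * (K * (Qm + (δ / m) ^ (1 - θ) * Qm ^ 2)) + 32 * (δ / m) * Qm ^ 2
        ≤ 2 * (K * (Qm + (δ / m) ^ (1 - θ) * Qm ^ 2)) + 32 * (δ / m) ^ (1 - θ) * Qm ^ 2
            + 32 * Qm := by
          have : 32 * (δ / m) * Qm ^ 2 ≤ 32 * (δ / m) ^ (1 - θ) * Qm ^ 2 := by gcongr
          linarith
      _ = (2 * K + 32) * (Qm + (δ / m) ^ (1 - θ) * Qm ^ 2) := by ring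
      _ ≤ (2 * K + 32) * (2 * Q / m + δ ^ (1 - θ) * (2 * Q / m) ^ 2) := by gcongr
      _ = _ := by field_simp; ring
  have hlogQ : 0 ≤ Real.log Q := Real.log_nonneg hQ
  have hlog : Real.log (2 * Q) ≤ 1 + Real.log Q := by
    rw [Real.log_mul (by norm_num) hQ0.ne']
    linarith [Real.log_two_lt_d9]
  have hs1 := sum_inv_Icc_le (x := 2 * Q) (by linarith)
  have hs2 := sum_inv_sq_Icc_le N
  have hpos : 0 ≤ δ ^ (1 - θ) * Q ^ 2 := by positivity
  calc (P.card : ℝ)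
      = ∑ m ∈ Finset.Icc 1 N, ((P.filter (fun p => (g p).toNat = m)).card : ℝ) := by
        exact_mod_cast Finset.card_eq_sum_card_fiberwise hmaps
    _ ≤ ∑ m ∈ Finset.Icc 1 N,
        (2 * K + 32) * (2 * Q * (1 / m) + 4 * (δ ^ (1 - θ) * Q ^ 2) * (1 / m ^ 2)) :=
        Finset.sum_le_sum hblock
    _ = (2 * K + 32) * (2 * Q * ∑ m ∈ Finset.Icc 1 N, (1 : ℝ) / m
        + 4 * (δ ^ (1 - θ) * Q ^ 2) * ∑ m ∈ Finset.Icc 1 N, (1 : ℝ) / m ^ 2) := by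
        rw [← Finset.mul_sum, Finset.sum_add_distrib, ← Finset.mul_sum, ← Finset.mul_sum]
    _ ≤ (2 * K + 32) * (2 * Q * (1 + (1 + Real.log Q)) + 4 * (δ ^ (1 - θ) * Q ^ 2) * 2) := by
        gcongr
        linarith
    _ ≤ (2 * K + 32) * (8 * (Q * (1 + Real.log Q) + δ ^ (1 - θ) * Q ^ 2)) := by
        gcongr
        have := mul_nonneg hQ0.le hlogQ
        linarith
    _ = _ := by ring

/-- Sum over dyadic blocks of a bound which is quadratic in the block size. -/
theorem sum_dyadic_le {U V : ℝ} (hU : 0 ≤ U) (hV : 0 ≤ V) {n : ℕ} {J : ℝ} (hn : 2 ^ n ≤ J) :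
    ∑ m ∈ Finset.range (n + 1), (2 ^ m * U + V * (2 ^ m) ^ 2) / √2 ^ m ≤
      4 * (√J * U + V * (J * √J)) := by
  have hs2 : √2 * √2 = 2 := Real.mul_self_sqrt (by norm_num)
  have hs0 : 0 < √2 := by positivity
  have hs : (4 : ℝ) / 3 ≤ √2 := Real.le_sqrt_of_sq_le (by norm_num)
  have hs' : 1 < 2 * √2 := by linarith
  have hJ0 : 0 ≤ J := le_trans (by positivity) hn
  have hn' : √2 ^ n ≤ √J := by
    apply Real.le_sqrt_of_sq_le
    calc (√2 ^ n) ^ 2 = (√2 * √2) ^ n := by rw [← pow_mul, mul_comm n 2, pow_mul, sq]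
      _ = 2 ^ n := by rw [hs2]
      _ ≤ J := hn
  have hterm : ∀ m : ℕ, (2 ^ m * U + V * (2 ^ m) ^ 2) / √2 ^ m =
      U * √2 ^ m + V * (2 * √2) ^ m := by
    intro m
    rw [div_eq_iff (by positivity)]
    have e : (2 : ℝ) ^ m = √2 ^ m * √2 ^ m := by rw [← mul_pow, hs2]
    rw [mul_pow, e]
    ring
  simp only [hterm]
  rw [Finset.sum_add_distrib, ← Finset.mul_sum, ← Finset.mul_sum]
  have g1 : ∑ m ∈ Finset.range (n + 1), √2 ^ m ≤ 4 * √J := by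
    refine (geom_sum_le_div (by linarith) _).trans ?_
    rw [div_le_iff₀ (by linarith), pow_succ]
    have : √2 ^ n * √2 ≤ √J * √2 := by gcongr
    have h3 : 0 ≤ √J := by positivity
    nlinarith
  have g2 : ∑ m ∈ Finset.range (n + 1), (2 * √2) ^ m ≤ 4 * (J * √J) := by
    refine (geom_sum_le_div hs' _).trans ?_
    rw [div_le_iff₀ (by linarith), pow_succ, mul_pow]
    have h3 : 2 ^ n * √2 ^ n ≤ J * √J := by gcongr
    have h4 : 0 ≤ J * √J := by positivity
    nlinarith
  nlinarith [mul_le_mul_of_nonneg_left g1 hU, mul_le_mul_of_nonneg_left g2 hV]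

theorem exists_weighted_pair_le {A θ R : ℝ} (hA : 1 ≤ A) (hθ : 0 < θ) (hθ1 : θ ≤ 1) :
    ∃ K : ℝ, 0 < K ∧ ∀ h h' k k' : ℝ → ℝ, LegendrePair A h h' k k' → ∀ (J : ℕ) (δ : ℝ), 2 ≤ J →
      0 < δ → δ ≤ 1 → ∀ P : Finset (ℤ × ℤ),
      (∀ p ∈ P, 1 ≤ p.1 ∧ p.1 ≤ J ∧ |(p.2 : ℝ)| ≤ R * p.1 ∧
        ∃ b : ℤ, |(b : ℝ) - p.1 * h (p.2 / p.1)| ≤ δ) →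
      ∑ p ∈ P, 1 / √(p.1 : ℝ) ≤ K * (√J * Real.log J + δ ^ (1 - θ) * (J * √J)) := by
  obtain ⟨K, hK, hB⟩ := exists_card_pair_le hA hθ hθ1
  set I : Finset ℤ := Finset.Icc ⌊-R⌋ ⌊R⌋ with hI
  refine ⟨12 * (I.card + 1) * K, by positivity, fun h h' k k' H J δ hJ hδ hδ1 P hP => ?_⟩
  have hJ1 : (1 : ℝ) ≤ J := by exact_mod_cast (by omega : 1 ≤ J)
  set D := δ ^ (1 - θ) with hD
  have hD0 : 0 ≤ D := by positivity
  set e : ℤ × ℤ → ℕ := fun p => Nat.log 2 p.1.toNat with he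
  have hpow : ∀ p ∈ P, (2 : ℝ) ^ e p ≤ p.1 ∧ (p.1 : ℝ) < 2 * 2 ^ e p := by
    intro p hp
    have hn := (hP p hp).1
    have h1 := Nat.pow_log_le_self 2 (x := p.1.toNat) (by omega)
    have h2 := Nat.lt_pow_succ_log_self (b := 2) (by norm_num) p.1.toNat
    have hz : ((p.1.toNat : ℕ) : ℝ) = p.1 := by
      exact_mod_cast Int.toNat_of_nonneg (by omega : 0 ≤ p.1)
    rw [pow_succ, mul_comm] at h2
    constructor
    · rw [← hz]; exact_mod_cast h1
    · rw [← hz]; exact_mod_cast h2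
  set n := Nat.log 2 J with hn
  have hnJ : (2 : ℝ) ^ n ≤ J := by exact_mod_cast Nat.pow_log_le_self 2 (x := J) (by omega)
  have heK : ∀ p ∈ P, e p ∈ Finset.range (n + 1) := by
    intro p hp
    have h1 := (hP p hp).2.1
    exact Finset.mem_range.2 (Nat.lt_succ_of_le (Nat.log_mono_right (by omega)))
  have hblock : ∀ m ∈ Finset.range (n + 1), ((P.filter (fun p => e p = m)).card : ℝ) ≤
      I.card * (K * (2 ^ m * (1 + Real.log J) + D * (2 ^ m) ^ 2)) := by
    intro m hm
    have hm2 : (1 : ℝ) ≤ 2 ^ m := one_le_pow₀ (by norm_num)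
    have hmJ : (2 : ℝ) ^ m ≤ J :=
      (pow_le_pow_right₀ (by norm_num) (Nat.lt_succ_iff.1 (Finset.mem_range.1 hm))).trans hnJ
    have hmaps : ∀ p ∈ P.filter (fun p => e p = m), ⌊(p.2 / p.1 : ℝ)⌋ ∈ I := by
      intro p hp
      obtain ⟨h1, -, h2, -⟩ := hP p (Finset.mem_filter.1 hp).1
      have hp0 : (0 : ℝ) < p.1 := by exact_mod_cast (by omega : 0 < p.1)
      rw [abs_le] at h2
      refine Finset.mem_Icc.2 ⟨Int.floor_mono ?_, Int.floor_mono ?_⟩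
      · rw [le_div_iff₀ hp0]; linarith
      · rw [div_le_iff₀ hp0]; linarith
    rw [Finset.card_eq_sum_card_fiberwise hmaps, Nat.cast_sum, ← nsmul_eq_mul, ← Finset.sum_const]
    apply Finset.sum_le_sum
    intro u _
    refine (hB h h' k k' H (2 ^ m) δ u hm2 hδ hδ1 _ fun p hp => ?_).trans ?_
    · obtain ⟨hp1, hu⟩ := Finset.mem_filter.1 hp
      obtain ⟨hp2, hm'⟩ := Finset.mem_filter.1 hp1
      obtain ⟨l1, l2⟩ := hpow p hp2
      rw [hm'] at l1 l2
      refine ⟨l1, l2, ?_, ?_, (hP p hp2).2.2.2⟩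
      · rw [← hu]; exact Int.floor_le _
      · rw [← hu]; exact (Int.lt_floor_add_one _).le
    · gcongr
  have hlogJ : 1 + Real.log J ≤ 3 * Real.log J := by
    have h1 : Real.log 2 ≤ Real.log J := by
      apply Real.log_le_log (by norm_num)
      exact_mod_cast hJ
    linarith [Real.log_two_gt_d9]
  have hlog0 : 0 ≤ Real.log J := Real.log_nonneg hJ1
  calc ∑ p ∈ P, 1 / √(p.1 : ℝ) ≤ ∑ p ∈ P, 1 / √2 ^ e p := by
        apply Finset.sum_le_sum
        intro p hp
        have : √2 ^ e p ≤ √(p.1 : ℝ) := by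
          apply Real.le_sqrt_of_sq_le
          rw [← pow_mul, mul_comm, pow_mul, Real.sq_sqrt (by norm_num)]
          exact (hpow p hp).1
        gcongr
    _ = ∑ m ∈ Finset.range (n + 1), ∑ p ∈ P.filter (fun p => e p = m), 1 / √2 ^ e p :=
        (Finset.sum_fiberwise_of_maps_to heK _).symm
    _ ≤ ∑ m ∈ Finset.range (n + 1), I.card * K *
          ((2 ^ m * (1 + Real.log J) + D * (2 ^ m) ^ 2) / √2 ^ m) := by
        apply Finset.sum_le_sum
        intro m hm
        have : ∑ p ∈ P.filter (fun p => e p = m), 1 / √2 ^ e p =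
            (P.filter (fun p => e p = m)).card * (1 / √2 ^ m) := by
          rw [← nsmul_eq_mul, ← Finset.sum_const]
          exact Finset.sum_congr rfl fun p hp => by rw [(Finset.mem_filter.1 hp).2]
        rw [this]
        calc ((P.filter (fun p => e p = m)).card : ℝ) * (1 / √2 ^ m)
            ≤ I.card * (K * (2 ^ m * (1 + Real.log J) + D * (2 ^ m) ^ 2)) * (1 / √2 ^ m) :=
              mul_le_mul_of_nonneg_right (hblock m hm) (by positivity)
          _ = _ := by ring
    _ = I.card * K * ∑ m ∈ Finset.range (n + 1),
          (2 ^ m * (1 + Real.log J) + D * (2 ^ m) ^ 2) / √2 ^ m := by rw [Finset.mul_sum]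
    _ ≤ (I.card + 1) * K * (4 * (√J * (1 + Real.log J) + D * (J * √J))) := by
        gcongr
        · linarith
        · exact sum_dyadic_le (by positivity) hD0 hnJ
    _ ≤ (I.card + 1) * K * (4 * (√J * (3 * Real.log J) + 3 * (D * (J * √J)))) := by
        have h1 : 0 ≤ D * (J * √J) := by positivity
        have h2 : √J * (1 + Real.log J) ≤ √J * (3 * Real.log J) := by gcongr
        apply mul_le_mul_of_nonneg_left _ (by positivity)
        linarith
    _ = _ := by ring

theorem tangent_le_of_monotone_deriv {φ φ' : ℝ → ℝ} (hφ : ∀ x, HasDerivAt φ (φ' x) x)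
    (hmono : Monotone φ') (x y : ℝ) : 0 ≤ φ y - φ x - φ' x * (y - x) := by
  have hc : Continuous φ := continuous_iff_continuousAt.2 fun x => (hφ x).continuousAt
  rcases lt_trichotomy x y with h | rfl | h
  · obtain ⟨c, hc1, hc2⟩ := exists_hasDerivAt_eq_slope φ φ' h hc.continuousOn fun x _ => hφ x
    rw [eq_div_iff (sub_pos.2 h).ne'] at hc2
    nlinarith [mul_nonneg (sub_nonneg.2 (hmono hc1.1.le)) (sub_pos.2 h).le]
  · simp
  · obtain ⟨c, hc1, hc2⟩ := exists_hasDerivAt_eq_slope φ φ' h hc.continuousOn fun x _ => hφ x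
    rw [eq_div_iff (sub_pos.2 h).ne'] at hc2
    nlinarith [mul_nonneg (sub_nonneg.2 (hmono hc1.2.le)) (sub_pos.2 h).le]

section Taylor

variable {c₁ c₂ : ℝ} {k k' k'' : ℝ → ℝ}

theorem le_taylor_remainder (hk : ∀ x, HasDerivAt k (k' x) x)
    (hk' : ∀ x, HasDerivAt k' (k'' x) x) (hc : ∀ x, c₁ ≤ k'' x) (x y : ℝ) :
    c₁ * (y - x) ^ 2 / 2 ≤ k y - k x - k' x * (y - x) := by
  have hmono : Monotone fun t => k' t - c₁ * t :=
    monotone_of_hasDerivAt_nonneg (f' := fun t => k'' t - c₁ * 1)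
      (fun t => (hk' t).sub ((hasDerivAt_id t).const_mul c₁)) fun t => by
        have := hc t
        simp only [Pi.zero_apply]
        linarith
  have hd : ∀ t, HasDerivAt (fun t => k t - c₁ / 2 * t ^ 2) (k' t - c₁ * t) t := fun t =>
    ((hk t).sub ((hasDerivAt_pow 2 t).const_mul (c₁ / 2))).congr_deriv (by
      norm_num
      ring)
  have := tangent_le_of_monotone_deriv hd hmono x y
  linarith

theorem taylor_remainder_le (hk : ∀ x, HasDerivAt k (k' x) x)
    (hk' : ∀ x, HasDerivAt k' (k'' x) x) (hc : ∀ x, k'' x ≤ c₂) (x y : ℝ) :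
    k y - k x - k' x * (y - x) ≤ c₂ * (y - x) ^ 2 / 2 := by
  have := le_taylor_remainder (c₁ := -c₂) (fun x => (hk x).neg) (fun x => (hk' x).neg)
    (fun x => neg_le_neg (hc x)) x y
  simp only [Pi.neg_apply] at this
  linarith

theorem exists_deriv_sub_eq_mul (hk' : ∀ x, HasDerivAt k' (k'' x) x) (x y : ℝ) :
    ∃ c, k' y - k' x = k'' c * (y - x) := by
  have hc : Continuous k' := continuous_iff_continuousAt.2 fun x => (hk' x).continuousAt
  rcases lt_trichotomy x y with h | rfl | h
  · obtain ⟨c, -, hc2⟩ := exists_hasDerivAt_eq_slope k' k'' h hc.continuousOn fun x _ => hk' x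
    rw [eq_div_iff (sub_pos.2 h).ne'] at hc2
    exact ⟨c, hc2.symm⟩
  · exact ⟨0, by simp⟩
  · obtain ⟨c, -, hc2⟩ := exists_hasDerivAt_eq_slope k' k'' h hc.continuousOn fun x _ => hk' x
    rw [eq_div_iff (sub_pos.2 h).ne'] at hc2
    exact ⟨c, by linarith⟩

theorem exists_legendrePair {G : ℝ → ℝ} (h₁ : 0 < c₁) (h₁₂ : c₁ ≤ c₂)
    (hk : ∀ x, HasDerivAt k (k' x) x) (hk' : ∀ x, HasDerivAt k' (k'' x) x)
    (hc : ∀ x, c₁ ≤ k'' x ∧ k'' x ≤ c₂) (hG : ∀ w, k' (G w) = w) (hG' : ∀ x, G (k' x) = x) :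
    ∃ A, 1 ≤ A ∧ LegendrePair A (fun w => w * G w - k (G w)) G k k' := by
  have h₂ : 0 < c₂ := h₁.trans_le h₁₂
  set A := 1 + 1 / c₁ + c₂ + c₂ ^ 2 / c₁ + c₂ / c₁ ^ 2 with hA
  have p1 : 0 < 1 / c₁ := by positivity
  have p2 : 0 < c₂ ^ 2 / c₁ := by positivity
  have p3 : 0 < c₂ / c₁ ^ 2 := by positivity
  have hA1 : 1 ≤ A := by linarith
  have a1 : 1 ≤ A * c₁ := by rw [← div_le_iff₀ h₁]; linarith
  have a2 : c₂ ≤ A := by linarith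
  have a3 : c₂ ^ 2 ≤ A * c₁ := by rw [← div_le_iff₀ h₁]; linarith
  have a4 : c₂ ≤ A * c₁ ^ 2 := by rw [← div_le_iff₀ (by positivity)]; linarith
  have lo := le_taylor_remainder hk hk' fun x => (hc x).1
  have hi := taylor_remainder_le hk hk' fun x => (hc x).2
  have hw : ∀ v w, c₁ ^ 2 * (G w - G v) ^ 2 ≤ (w - v) ^ 2 ∧
      (w - v) ^ 2 ≤ c₂ ^ 2 * (G w - G v) ^ 2 := by
    intro v w
    obtain ⟨t, ht⟩ := exists_deriv_sub_eq_mul hk' (G v) (G w)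
    rw [hG, hG] at ht
    rw [ht, mul_pow]
    have := hc t
    have h0 : 0 ≤ k'' t := h₁.le.trans this.1
    constructor <;> gcongr
    · exact this.1
    · exact this.2
  have hrem : ∀ v w, (w * G w - k (G w)) - (v * G v - k (G v)) - G v * (w - v) =
      k (G v) - k (G w) - k' (G w) * (G v - G w) := by
    intro v w; rw [hG]; ring
  refine ⟨A, hA1, ?_, ?_, ?_, ?_, hG, hG', ?_⟩
  · intro v w
    rw [hrem]
    refine le_trans ?_ (lo _ _)
    rw [div_le_iff₀ (by positivity)]
    nlinarith [hw v w, mul_le_mul_of_nonneg_right a3 (sq_nonneg (G w - G v))]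
  · intro v w
    rw [hrem]
    refine (hi _ _).trans ?_
    nlinarith [hw v w, mul_le_mul_of_nonneg_right a4 (sq_nonneg (G w - G v)),
      mul_le_mul_of_nonneg_left (hw v w).1 (zero_le_one.trans hA1)]
  · intro x y
    refine le_trans ?_ (lo _ _)
    rw [div_le_iff₀ (by positivity)]
    nlinarith [mul_le_mul_of_nonneg_right a1 (sq_nonneg (y - x))]
  · intro x y
    refine (hi _ _).trans ?_
    gcongr
  · intro w
    ring

end Taylor

theorem volume_le_ofReal_of_dist_le {S : Set ℝ} {d : ℝ}
    (hS : ∀ x ∈ S, ∀ y ∈ S, x ≤ y → y - x ≤ d) : volume S ≤ ENNReal.ofReal d := by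
  refine (Real.volume_le_diam S).trans (Metric.ediam_le fun x hx y hy => ?_)
  rw [edist_dist]
  apply ENNReal.ofReal_le_ofReal
  rw [Real.dist_eq]
  rcases le_total x y with h | h
  · rw [abs_sub_comm, abs_of_nonneg (sub_nonneg.2 h)]; exact hS x hx y hy h
  · rw [abs_of_nonneg (sub_nonneg.2 h)]; exact hS y hy x hx h

/-- The sublevel sets of `|k - w • id + c|` have measure at most `4 √(A r)`. -/
theorem LegendrePair.volume_sublevel_le {A : ℝ} {h h' k k' : ℝ → ℝ} (H : LegendrePair A h h' k k')
    (hA : 1 ≤ A) (w c r : ℝ) :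
    volume {x | |k x - w * x + c| < r} ≤ ENNReal.ofReal (4 * √(A * r)) := by
  set S := {x | |k x - w * x + c| < r} with hS
  have key : ∀ x ∈ S, ∀ y ∈ S, (y - x) ^ 2 / (2 * A) ≤ |(k y - w * y) - (k x - w * x)| →
      y - x ≤ 2 * √(A * r) := by
    intro x hx y hy hxy
    rw [hS, mem_ofPred_eq] at hx hy
    have h1 : |(k y - w * y) - (k x - w * x)| ≤ 2 * r := by
      rw [abs_lt] at hx hy
      rw [abs_le]
      constructor <;> linarith
    have h2 := hxy.trans h1
    rw [div_le_iff₀ (by positivity)] at h2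
    have h3 : (2 : ℝ) * √(A * r) = √(4 * (A * r)) := by
      rw [show 4 * (A * r) = 2 ^ 2 * (A * r) by ring,
        Real.sqrt_mul (show (0 : ℝ) ≤ 2 ^ 2 by norm_num) (A * r), Real.sqrt_sq (by norm_num)]
    rw [h3]
    exact Real.le_sqrt_of_sq_le (by linarith)
  have hcover : S ⊆ (S ∩ Ici (h' w)) ∪ (S ∩ Iic (h' w)) := fun x hx =>
    (le_total (h' w) x).imp (fun h => ⟨hx, h⟩) fun h => ⟨hx, h⟩
  have e : (4 : ℝ) * √(A * r) = 2 * √(A * r) + 2 * √(A * r) := by ring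
  rw [e, ENNReal.ofReal_add (by positivity) (by positivity)]
  refine (measure_mono hcover).trans ((measure_union_le _ _).trans (add_le_add ?_ ?_))
  · refine volume_le_ofReal_of_dist_le fun x hx y hy hxy => key x hx.1 y hy.1 ?_
    exact (H.symm.growth_right hA hx.2 hxy).trans (le_abs_self _)
  · refine volume_le_ofReal_of_dist_le fun x hx y hy hxy => key x hx.1 y hy.1 ?_
    have h1 := H.lower_dual y x
    have h2 := H.symm.mono_deriv hA hy.2
    rw [H.left_inv] at h2
    refine le_trans ?_ (neg_le_abs _)
    rw [← neg_sub x y, neg_sq]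
    nlinarith [mul_nonneg (sub_nonneg.2 h2) (sub_nonneg.2 hxy)]

theorem Int.cast_mul_self_eq_one {s : ℤ} (hs : s * s = 1) : (s : ℝ) * s = 1 := by
  exact_mod_cast hs

theorem Int.abs_cast_mul_of_mul_self {s : ℤ} (hs : s * s = 1) (x : ℝ) : |(s : ℝ) * x| = |x| := by
  have : |(s : ℝ)| = 1 := by
    have h := abs_mul_abs_self (s : ℝ)
    rw [Int.cast_mul_self_eq_one hs] at h
    nlinarith [abs_nonneg (s : ℝ)]
  rw [abs_mul, this, one_mul]

section Sum

variable {A R : ℝ} {h h' k k' f : ℝ → ℝ} {F : ℤ × ℤ → ℝ} {s : ℤ}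

theorem LegendrePair.toReal_volume_le (H : LegendrePair A h h' k k') (hA : 1 ≤ A)
    (hs : s * s = 1) (hf : ∀ x, f x = -s * k x) (S : Set ℝ) (j : ℤ × ℤ) {σ : ℤ}
    (hσ : σ * σ = 1) (hj : 0 < σ * j.2) (c : ℝ) {lam : ℝ} :
    (volume {x ∈ S | |(j.1 : ℝ) * x + (j.2 : ℝ) * f x - c| < lam}).toReal ≤
      4 * √A * √lam * (1 / √((σ * j.2 : ℤ) : ℝ)) := by
  set q : ℝ := ((σ * j.2 : ℤ) : ℝ) with hq
  have hq0 : 0 < q := by rw [hq]; exact_mod_cast hj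
  set τ : ℤ := s * σ with hτ
  have hττ : τ * τ = 1 := by rw [hτ]; linear_combination s * s * hσ + hs
  have hsub : {x ∈ S | |(j.1 : ℝ) * x + (j.2 : ℝ) * f x - c| < lam} ⊆
      {x | |k x - (τ * j.1 / q) * x + τ * c / q| < lam / q} := by
    rintro x ⟨-, hx⟩
    rw [mem_ofPred_eq, lt_div_iff₀ hq0, ← abs_of_pos hq0, ← abs_mul, abs_of_pos hq0]
    have h1 := Int.cast_mul_self_eq_one hs
    have h2 : (τ : ℝ) = s * σ := by rw [hτ]; push_cast; ring
    have h3 : q = σ * j.2 := by rw [hq]; push_cast; ring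
    have h4 : (k x - τ * j.1 / q * x + τ * c / q) * q = k x * q - τ * j.1 * x + τ * c := by
      field_simp
    have h5 : (k x - τ * j.1 / q * x + τ * c / q) * q = -(τ * (j.1 * x + j.2 * f x - c)) := by
      rw [h4, hf, h2, h3]
      linear_combination (-(σ * j.2 * k x : ℝ)) * h1
    rwa [h5, abs_neg, Int.abs_cast_mul_of_mul_self hττ]
  have h1 := (measure_mono hsub).trans (H.volume_sublevel_le hA _ _ _)
  refine (ENNReal.toReal_le_of_le_ofReal (by positivity) h1).trans (le_of_eq ?_)
  rw [Real.sqrt_mul (by linarith), Real.sqrt_div' _ hq0.le]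
  ring

theorem LegendrePair.sum_volume_le (H : LegendrePair A h h' k k') (hA : 1 ≤ A)
    (hs : s * s = 1) (hf : ∀ x, f x = -s * k x)
    (hF : ∀ j : ℤ × ℤ, j.2 ≠ 0 → F j = s * (j.2 * h (s * (j.1 / j.2)))) (S : Set ℝ)
    {J : ℕ} {lam B : ℝ} (c : ℤ × ℤ → ℝ)
    (hB : ∀ P : Finset (ℤ × ℤ), (∀ p ∈ P, 1 ≤ p.1 ∧ p.1 ≤ J ∧ |(p.2 : ℝ)| ≤ R * p.1 ∧
      ∃ b : ℤ, |(b : ℝ) - p.1 * h (p.2 / p.1)| ≤ 2 * lam) → ∑ p ∈ P, 1 / √(p.1 : ℝ) ≤ B)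
    (T : Finset (ℤ × ℤ)) {σ : ℤ} (hσ : σ * σ = 1)
    (hT : ∀ j ∈ T, 0 < σ * j.2 ∧ σ * j.2 ≤ J ∧ |(j.1 : ℝ)| ≤ R * |(j.2 : ℝ)| ∧
      nint (F j) < 2 * lam) :
    ∑ j ∈ T, (volume {x ∈ S | |(j.1 : ℝ) * x + (j.2 : ℝ) * f x - c j| < lam}).toReal ≤
      4 * √A * √lam * B := by
  set φ : ℤ × ℤ → ℤ × ℤ := fun j => (σ * j.2, s * σ * j.1) with hφ
  have hinj : InjOn φ T := by
    intro i _ j _ hij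
    simp only [hφ, Prod.mk.injEq] at hij
    refine Prod.ext ?_ ?_
    · linear_combination (s * σ) * hij.2 - (s * s * (i.1 - j.1)) * hσ - (i.1 - j.1) * hs
    · linear_combination σ * hij.1 - (i.2 - j.2) * hσ
  have hτ : s * σ * (s * σ) = 1 := by linear_combination s * s * hσ + hs
  have key := hB (T.image φ) fun p hp => by
    obtain ⟨j, hj, rfl⟩ := Finset.mem_image.1 hp
    obtain ⟨h1, h2, h3, h4⟩ := hT j hj
    have hj0 : j.2 ≠ 0 := by rintro h0; simp [h0] at h1
    have hσr := Int.cast_mul_self_eq_one hσ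
    have hsr := Int.cast_mul_self_eq_one hs
    have hσ0 : (σ : ℝ) ≠ 0 := left_ne_zero_of_mul_eq_one hσr
    have hj0' : (j.2 : ℝ) ≠ 0 := by exact_mod_cast hj0
    refine ⟨h1, h2, ?_, s * σ * round (F j), ?_⟩
    · have e1 : ((σ * j.2 : ℤ) : ℝ) = |(j.2 : ℝ)| := by
        rw [← Int.abs_cast_mul_of_mul_self hσ, ← Int.cast_mul, abs_of_pos]
        exact_mod_cast h1
      have e2 : ((s * σ * j.1 : ℤ) : ℝ) = ((s * σ : ℤ) : ℝ) * j.1 := by push_cast; ring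
      simp only [hφ]
      rw [e1, e2, Int.abs_cast_mul_of_mul_self hτ]
      exact h3
    · refine le_trans (le_of_eq ?_) h4.le
      have e : (s : ℝ) * (j.1 / j.2) = ((s * σ * j.1 : ℤ) : ℝ) / ((σ * j.2 : ℤ) : ℝ) := by
        push_cast
        field_simp
      unfold nint
      rw [hF j hj0, e, ← Int.abs_cast_mul_of_mul_self hτ, abs_sub_comm]
      congr 1
      simp only [hφ]
      push_cast
      generalize h (s * σ * j.1 / (σ * j.2)) = y
      generalize ((round ((s : ℝ) * (j.2 * y)) : ℤ) : ℝ) = z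
      linear_combination (z * s ^ 2 - s * j.2 * y) * hσr + z * hsr
  rw [Finset.sum_image hinj] at key
  calc _ ≤ ∑ j ∈ T, 4 * √A * √lam * (1 / √((σ * j.2 : ℤ) : ℝ)) :=
        Finset.sum_le_sum fun j hj => H.toReal_volume_le hA hs hf S j hσ (hT j hj).1 _
    _ = 4 * √A * √lam * ∑ j ∈ T, (1 / √((σ * j.2 : ℤ) : ℝ)) := by rw [Finset.mul_sum]
    _ ≤ _ := by gcongr

theorem LegendrePair.exists_sum_volume_le (H : LegendrePair A h h' k k') (hA : 1 ≤ A)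
    (hs : s * s = 1) (hf : ∀ x, f x = -s * k x)
    (hF : ∀ j : ℤ × ℤ, j.2 ≠ 0 → F j = s * (j.2 * h (s * (j.1 / j.2)))) (S : Set ℝ)
    (c : ℤ × ℤ → ℝ) (R : ℝ) {ε : ℝ} (hε : 0 < ε) :
    ∃ K : ℝ, 0 < K ∧ ∀ J : ℕ, 2 ≤ J → ∀ lam : ℝ, 0 < lam → lam ≤ 1/8 →
      ∑ j ∈ (Finset.Icc (-(J : ℤ)) J ×ˢ Finset.Icc (-(J : ℤ)) J).filter
          (fun j => j.2 ≠ 0 ∧ |(j.1 : ℝ)| ≤ R * |(j.2 : ℝ)| ∧ nint (F j) < 2 * lam),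
        (volume {x ∈ S | |(j.1 : ℝ) * x + (j.2 : ℝ) * f x - c j| < lam}).toReal
      ≤ K * (lam ^ ((3 : ℝ)/2 - ε) * (J : ℝ) ^ ((3 : ℝ)/2)
              + lam ^ ((1 : ℝ)/2) * (J : ℝ) ^ ((1 : ℝ)/2) * Real.log J) := by
  set θ := min ε 1 with hθ
  have hθ0 : 0 < θ := lt_min hε one_pos
  have hθ1 : θ ≤ 1 := min_le_right _ _
  obtain ⟨K, hK, hbound⟩ := exists_weighted_pair_le (R := R) hA hθ0 hθ1
  refine ⟨16 * √A * K, by positivity, fun J hJ lam hlam hlam1 => ?_⟩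
  set T := (Finset.Icc (-(J : ℤ)) J ×ˢ Finset.Icc (-(J : ℤ)) J).filter
          (fun j => j.2 ≠ 0 ∧ |(j.1 : ℝ)| ≤ R * |(j.2 : ℝ)| ∧ nint (F j) < 2 * lam) with hTdef
  set B := K * (√J * Real.log J + (2 * lam) ^ (1 - θ) * (J * √J)) with hBdef
  have hB := hbound h h' k k' H J (2 * lam) hJ (by linarith) (by linarith)
  rw [← hBdef] at hB
  have hmem : ∀ j ∈ T, -(J : ℤ) ≤ j.2 ∧ j.2 ≤ J ∧ j.2 ≠ 0 ∧ |(j.1 : ℝ)| ≤ R * |(j.2 : ℝ)| ∧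
      nint (F j) < 2 * lam := by
    intro j hj
    simp only [hTdef, Finset.mem_filter, Finset.mem_product, Finset.mem_Icc] at hj
    exact ⟨hj.1.2.1, hj.1.2.2, hj.2⟩
  have hpos := H.sum_volume_le hA hs hf hF S c hB (T.filter fun j => 0 < j.2) (σ := 1)
    (by norm_num) fun j hj => by
      obtain ⟨hj, h0⟩ := Finset.mem_filter.1 hj
      obtain ⟨h1, h2, h3, h4⟩ := hmem j hj
      exact ⟨by omega, by omega, h4⟩
  have hneg := H.sum_volume_le hA hs hf hF S c hB (T.filter fun j => ¬ 0 < j.2) (σ := -1)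
    (by norm_num) fun j hj => by
      obtain ⟨hj, h0⟩ := Finset.mem_filter.1 hj
      obtain ⟨h1, h2, h3, h4⟩ := hmem j hj
      exact ⟨by omega, by omega, h4⟩
  rw [← Finset.sum_filter_add_sum_filter_not T fun j => 0 < j.2]
  have hJ0 : (0 : ℝ) < J := by exact_mod_cast (by omega : 0 < J)
  have hlog : 0 ≤ Real.log J := Real.log_natCast_nonneg J
  have e1 : (J : ℝ) * √J = (J : ℝ) ^ ((3 : ℝ) / 2) := by
    rw [Real.sqrt_eq_rpow, ← Real.rpow_one_add' hJ0.le (by norm_num)]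
    norm_num
  have e2 : √lam * (2 * lam) ^ (1 - θ) ≤ 2 * lam ^ ((3 : ℝ) / 2 - ε) := by
    rw [Real.mul_rpow (by norm_num) hlam.le, mul_left_comm, Real.sqrt_eq_rpow,
      ← Real.rpow_add hlam]
    have a1 : (2 : ℝ) ^ (1 - θ) ≤ 2 ^ (1 : ℝ) :=
      Real.rpow_le_rpow_of_exponent_le (by norm_num) (by linarith)
    rw [Real.rpow_one] at a1
    have a2 : lam ^ ((1 : ℝ) / 2 + (1 - θ)) ≤ lam ^ ((3 : ℝ) / 2 - ε) :=
      Real.rpow_le_rpow_of_exponent_ge hlam (by linarith) (by linarith [min_le_left ε 1])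
    gcongr
  calc _ ≤ 8 * √A * √lam * B := by linarith
    _ = 8 * √A * K * (√lam * (2 * lam) ^ (1 - θ) * (J * √J) + √lam * √J * Real.log J) := by
        rw [hBdef]; ring
    _ ≤ 8 * √A * K * (2 * lam ^ ((3 : ℝ) / 2 - ε) * (J * √J)
          + 2 * (√lam * √J * Real.log J)) := by
        have : 0 ≤ √lam * √J * Real.log J := by positivity
        apply mul_le_mul_of_nonneg_left _ (by positivity)
        refine add_le_add ?_ (by linarith)
        gcongr
    _ = _ := by
        rw [e1, Real.sqrt_eq_rpow lam, Real.sqrt_eq_rpow (J : ℝ)]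
        ring

end Sum

theorem pos_or_neg_of_continuous {φ : ℝ → ℝ} (hφ : Continuous φ) (h0 : ∀ x, φ x ≠ 0) :
    (∀ x, 0 < φ x) ∨ ∀ x, φ x < 0 := by
  by_contra! hc
  obtain ⟨⟨x, hx⟩, y, hy⟩ := hc
  obtain ⟨z, -, hz⟩ := isPreconnected_univ.intermediate_value (mem_univ x) (mem_univ y)
    hφ.continuousOn (⟨hx, hy⟩ : (0 : ℝ) ∈ Icc (φ x) (φ y))
  exact h0 z hz

theorem sum_mu_p0_small_norm_bound
    (ε : ℝ) (hε : 0 < ε)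
    (ξ η c₁ c₂ : ℝ) (hξη : ξ ≤ η) (hc₁ : 0 < c₁) (hc₁₂ : c₁ ≤ c₂)
    (f f' f'' g : ℝ → ℝ)
    (hf : ∀ x, HasDerivAt f (f' x) x)
    (hf' : ∀ x, HasDerivAt f' (f'' x) x)
    (hf'' : Continuous f'')
    (hbd : ∀ x, c₁ ≤ |f'' x| ∧ |f'' x| ≤ c₂)
    (hg1 : ∀ y, f' (g y) = -y)
    (hg2 : ∀ x, g (-f' x) = x)
    (Mmax : ℝ) (hM : IsGreatest ((fun x => |f' x|) '' Icc ξ η) Mmax)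
    (F : ℤ × ℤ → ℝ)
    (hF : ∀ j : ℤ × ℤ,
      F j = (j.1 : ℝ) * g ((j.1 : ℝ) / (j.2 : ℝ)) + (j.2 : ℝ) * f (g ((j.1 : ℝ) / (j.2 : ℝ)))) :
    ∃ K : ℝ, 0 < K ∧ ∀ J : ℕ, 2 ≤ J → ∀ lam : ℝ, 0 < lam → lam ≤ 1/8 →
      ∑ j ∈ (Finset.Icc (-(J : ℤ)) J ×ˢ Finset.Icc (-(J : ℤ)) J).filter
          (fun j => j.2 ≠ 0 ∧ |(j.1 : ℝ)| ≤ 2 * (1 + Mmax) * |(j.2 : ℝ)| ∧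
            nint (F j) < 2 * lam),
        (volume {x ∈ Icc ξ η |
          |(j.1 : ℝ) * x + (j.2 : ℝ) * f x - ((⌈F j - 1/2⌉ : ℤ) : ℝ)| < lam}).toReal
      ≤ K * (lam ^ ((3 : ℝ)/2 - ε) * (J : ℝ) ^ ((3 : ℝ)/2)
              + lam ^ ((1 : ℝ)/2) * (J : ℝ) ^ ((1 : ℝ)/2) * Real.log J) := by
  have hsign := pos_or_neg_of_continuous hf'' fun x h0 => by
    have := (hbd x).1
    rw [h0, abs_zero] at this
    linarith
  rcases hsign with hp | hn
  · obtain ⟨A, hA, H⟩ := exists_legendrePair (G := fun w => g (-w)) hc₁ hc₁₂ hf hf'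
      (fun x => by simpa only [abs_of_pos (hp x)] using hbd x)
      (fun w => by rw [hg1, neg_neg]) hg2
    refine H.exists_sum_volume_le hA (s := -1) (by norm_num) (fun x => by push_cast; ring)
      (fun j hj => ?_) _ _ _ hε
    have hj' : (j.2 : ℝ) ≠ 0 := by exact_mod_cast hj
    rw [hF]
    push_cast
    simp only [neg_mul, one_mul, neg_neg]
    field_simp
    ring
  · obtain ⟨A, hA, H⟩ := exists_legendrePair (G := g) hc₁ hc₁₂ (fun x => (hf x).neg)
      (fun x => (hf' x).neg) (fun x => by simpa only [abs_of_neg (hn x)] using hbd x)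
      (fun w => by simp [hg1]) hg2
    refine H.exists_sum_volume_le hA (s := 1) (by norm_num) (fun x => by simp)
      (fun j hj => ?_) _ _ _ hε
    have hj' : (j.2 : ℝ) ≠ 0 := by exact_mod_cast hj
    rw [hF]
    push_cast
    simp only [one_mul, Pi.neg_apply]
    field_simp
    ring
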